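/- arXiv:0801.3260 — 3 statements merged into one kernel-verified Lean document; each statement's English description precedes it below -/
import Mathlib

section
/- (Weak cocommutativity for comodules.) Let M be a comodule over a graded vertex coalgebra (V, Y_V, c). For every v' ∈ (V ⊗ V ⊗ M)' there exists k ∈ ℤ_+ (depending only on v') such that for every w ∈ M, (x_1−x_2)^k ⟨v', (Id_V ⊗ Y_M(x_2))Y_M(x_1)w − (T ⊗ Id_M)(Id_V ⊗ Y_M(x_1))Y_M(x_2)w⟩ = 0 as a formal series in x_1, x_2. -/
/- Common background for the formalization of "Vertex coalgebras, comodules,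
cocommutativity and coassociativity" (K. Hubbard).

A vertex coalgebra `(V, Y, c)` is encoded by the family of coefficient maps
`Δ k : V →ₗ V ⊗ V` of the coproduct `Y(x)v = ∑ₖ Δ k v · x^(-k-1)` together with
the covacuum `c : V →ₗ F`.  All identities of formal series are encoded
coefficient-wise; in particular the Jacobi identity is encoded by its
(dual Borcherds) coefficient form. -/

noncomputable section

open scoped TensorProduct

variable (F : Type) [Field F] [CharZero F]

/-- The generalized binomial coefficient `(a choose i)` as an element of `F`. -/
def gchoose (a : ℤ) (i : ℕ) : F :=
  (∏ j ∈ Finset.range i, ((a : F) - (j : F))) / (Nat.factorial i : F)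

variable {V M : Type} [AddCommGroup V] [Module F V] [AddCommGroup M] [Module F M]

/-- `c ⊗ Id` composed with the canonical identification `F ⊗ M ≃ M`. -/
def cLeft (c : V →ₗ[F] F) : V ⊗[F] M →ₗ[F] M :=
  (TensorProduct.lid F M).toLinearMap ∘ₗ TensorProduct.map c LinearMap.id

/-- `Id ⊗ c` composed with the canonical identification `V ⊗ F ≃ V`. -/
def cRight (c : M →ₗ[F] F) : V ⊗[F] M →ₗ[F] V :=
  (TensorProduct.rid F V).toLinearMap ∘ₗ TensorProduct.map LinearMap.id c

/-- The transposition `T ⊗ Id` of the first two tensor factors of `V ⊗ (V ⊗ M)`. -/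
def Tfirst : V ⊗[F] (V ⊗[F] M) →ₗ[F] V ⊗[F] (V ⊗[F] M) :=
  (TensorProduct.assoc F V V M).toLinearMap ∘ₗ
    TensorProduct.map (TensorProduct.comm F V V).toLinearMap LinearMap.id ∘ₗ
    (TensorProduct.assoc F V V M).symm.toLinearMap

/-- The coefficient of `x₁^(-m-1) x₂^(-n-1)` in `(Id ⊗ Y(x₂)) Y(x₁)`. -/
def comp12 (ΔM : ℤ → M →ₗ[F] V ⊗[F] M) (m n : ℤ) : M →ₗ[F] V ⊗[F] (V ⊗[F] M) :=
  TensorProduct.map LinearMap.id (ΔM n) ∘ₗ ΔM m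

/-- The coefficient of `x₀^(-m-1) x₂^(-n-1)` in `(Y(x₀) ⊗ Id) Y(x₂)`. -/
def compR (ΔV : ℤ → V →ₗ[F] V ⊗[F] V) (ΔM : ℤ → M →ₗ[F] V ⊗[F] M) (m n : ℤ) :
    M →ₗ[F] V ⊗[F] (V ⊗[F] M) :=
  (TensorProduct.assoc F V V M).toLinearMap ∘ₗ TensorProduct.map (ΔV m) LinearMap.id ∘ₗ ΔM n

/-- The coefficient form of the (comodule) Jacobi identity of a vertex coalgebra,
obtained by extracting the coefficient of `x₀^(-a-1) x₁^(-b-1) x₂^(-c-1)`. -/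
def JacobiId (ΔV : ℤ → V →ₗ[F] V ⊗[F] V) (ΔM : ℤ → M →ₗ[F] V ⊗[F] M) : Prop :=
  ∀ (a b c : ℤ) (w : M),
    (∑ᶠ i : ℕ, ((-1 : F) ^ i * gchoose F a i) •
        (comp12 F ΔM (a + b - i) (c + i) w -
          (-1 : F) ^ a • Tfirst F (comp12 F ΔM (a + c - i) (b + i) w))) =
      ∑ᶠ i : ℕ, gchoose F b i • compR F ΔV ΔM (a + i) (b + c - i) w

/-- The axioms of a vertex coalgebra except the Jacobi identity: left counit,
cocreation and truncation, in coefficient form. -/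
def IsVertexCoalgSansJacobi (Δ : ℤ → V →ₗ[F] V ⊗[F] V) (c : V →ₗ[F] F) : Prop :=
  (∀ v : V, cLeft F c (Δ (-1) v) = v) ∧
  (∀ k : ℤ, k ≠ -1 → ∀ v : V, cLeft F c (Δ k v) = 0) ∧
  (∀ v : V, cRight F c (Δ (-1) v) = v) ∧
  (∀ k : ℤ, 0 ≤ k → ∀ v : V, cRight F c (Δ k v) = 0) ∧
  (∀ v : V, ∃ N : ℤ, ∀ k : ℤ, k < N → Δ k v = 0)

/-- The axioms of a vertex coalgebra. -/
def IsVertexCoalg (Δ : ℤ → V →ₗ[F] V ⊗[F] V) (c : V →ₗ[F] F) : Prop :=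
  IsVertexCoalgSansJacobi F Δ c ∧ JacobiId F Δ Δ

/-- The weight-`m` component of `V ⊗ V` for a graded space `V`. -/
def grT2 (gr : ℤ → Submodule F V) (m : ℤ) : Submodule F (V ⊗[F] V) :=
  ⨆ p : ℤ, LinearMap.range (TensorProduct.map (gr p).subtype (gr (m - p)).subtype)

/-- The weight-`m` component of `V ⊗ (V ⊗ V)` for a graded space `V`. -/
def grT3 (gr : ℤ → Submodule F V) (m : ℤ) : Submodule F (V ⊗[F] (V ⊗[F] V)) :=
  ⨆ p : ℤ × ℤ, LinearMap.range (TensorProduct.map (gr p.1).subtype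
    (TensorProduct.map (gr p.2).subtype (gr (m - p.1 - p.2)).subtype))

/-- The grading axioms of a graded vertex coalgebra: `V = ⊕ₖ V₍ₖ₎` internally,
`V₍ₖ₎ = 0` for `k` sufficiently small, and `Δ k` raises weight by `k + 1`. -/
def IsGradedVC (Δ : ℤ → V →ₗ[F] V ⊗[F] V) (gr : ℤ → Submodule F V) : Prop :=
  DirectSum.IsInternal gr ∧ (∃ N : ℤ, ∀ k : ℤ, k < N → gr k = ⊥) ∧
  (∀ r k : ℤ, ∀ v ∈ gr r, Δ k v ∈ grT2 F gr (r + k + 1))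

/-- `f` belongs to the graded dual `(V^{⊗3})'`: it vanishes on all but finitely
many homogeneous components of `V ⊗ V ⊗ V`. -/
def GradedDual3 (gr : ℤ → Submodule F V) (f : V ⊗[F] (V ⊗[F] V) →ₗ[F] F) : Prop :=
  ∃ s : Finset ℤ, ∀ m : ℤ, m ∉ s → ∀ u ∈ grT3 F gr m, f u = 0

/-- The weight-`q` component of `V ⊗ M` for `V` a `ℤ`-graded space and
`M` a `ℚ`-graded space. -/
def grVM (gr : ℤ → Submodule F V) (grM : ℚ → Submodule F M) (q : ℚ) :
    Submodule F (V ⊗[F] M) :=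
  ⨆ p : ℤ, LinearMap.range (TensorProduct.map (gr p).subtype (grM (q - p)).subtype)

/-- The weight-`q` component of `V ⊗ (V ⊗ M)`. -/
def grVVM (gr : ℤ → Submodule F V) (grM : ℚ → Submodule F M) (q : ℚ) :
    Submodule F (V ⊗[F] (V ⊗[F] M)) :=
  ⨆ p : ℤ × ℤ, LinearMap.range (TensorProduct.map (gr p.1).subtype
    (TensorProduct.map (gr p.2).subtype (grM (q - p.1 - p.2)).subtype))

/-- `f` belongs to the graded dual `(V ⊗ V ⊗ M)'`. -/
def GradedDualVVM (gr : ℤ → Submodule F V) (grM : ℚ → Submodule F M)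
    (f : V ⊗[F] (V ⊗[F] M) →ₗ[F] F) : Prop :=
  ∃ s : Finset ℚ, ∀ q : ℚ, q ∉ s → ∀ u ∈ grVVM F gr grM q, f u = 0

/-- The axioms of a comodule over a graded vertex coalgebra, except the Jacobi
identity: left counit, truncation, internal `ℚ`-grading bounded below, and the
grading condition on the comodule coproduct. -/
def IsComoduleSansJacobi (c : V →ₗ[F] F) (ΔM : ℤ → M →ₗ[F] V ⊗[F] M)
    (gr : ℤ → Submodule F V) (grM : ℚ → Submodule F M) : Prop :=
  (∀ w : M, cLeft F c (ΔM (-1) w) = w) ∧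
  (∀ k : ℤ, k ≠ -1 → ∀ w : M, cLeft F c (ΔM k w) = 0) ∧
  (∀ w : M, ∃ N : ℤ, ∀ k : ℤ, k < N → ΔM k w = 0) ∧
  DirectSum.IsInternal grM ∧ (∃ N : ℚ, ∀ q : ℚ, q < N → grM q = ⊥) ∧
  (∀ (j : ℚ) (k : ℤ), ∀ w ∈ grM j, ΔM k w ∈ grVM F gr grM (j + k + 1))

/-- Weak cocommutativity with exponent `k`, paired against `f`, coefficient-wise:
the coefficient of `x₁^(-b-1) x₂^(-c-1)` in
`(x₁-x₂)^k ⟨f, (Id ⊗ Y(x₂))Y(x₁)w - (T ⊗ Id)(Id ⊗ Y(x₁))Y(x₂)w⟩` vanishes. -/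
def WeakCocom (ΔM : ℤ → M →ₗ[F] V ⊗[F] M) (f : V ⊗[F] (V ⊗[F] M) →ₗ[F] F)
    (k : ℕ) : Prop :=
  ∀ (w : M) (b c : ℤ),
    ∑ j ∈ Finset.range (k + 1), ((-1 : F) ^ j * (k.choose j : F)) *
      (f (comp12 F ΔM (b + k - j) (c + j) w) -
        f (Tfirst F (comp12 F ΔM (c + j) (b + k - j) w))) = 0

/-- Weak coassociativity with exponent `k`, paired against `f`, coefficient-wise:
the coefficient of `x₀^(-a-1) x₂^(-c-1)` in
`(x₀+x₂)^k ⟨f, (Y(x₀) ⊗ Id)Y(x₂)w - (Id ⊗ Y(x₂))Y(x₀+x₂)w⟩` vanishes,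
`Y(x₀+x₂)` being expanded in nonnegative integral powers of `x₂`. -/
def WeakCoassoc (ΔV : ℤ → V →ₗ[F] V ⊗[F] V) (ΔM : ℤ → M →ₗ[F] V ⊗[F] M)
    (f : V ⊗[F] (V ⊗[F] M) →ₗ[F] F) (k : ℕ) : Prop :=
  ∀ (w : M) (a c : ℤ),
    ∑ j ∈ Finset.range (k + 1), (k.choose j : F) *
      (f (compR F ΔV ΔM (a + k - j) (c + j) w) -
        ∑ᶠ i : ℕ, ((-1 : F) ^ i * gchoose F (a + k - j) i) *
          f (comp12 F ΔM (a + k - j - i) (c + j + i) w)) = 0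

/-- The coefficient function of `x^r y^s (x + ε y)^t · A`, where `A : ℤ → ℤ → F`
is the coefficient function of a formal series (`A m n` is the coefficient of
`x^m y^n`). -/
def mulPoly (r s t : ℕ) (ε : F) (A : ℤ → ℤ → F) (m n : ℤ) : F :=
  ∑ j ∈ Finset.range (t + 1), (t.choose j : F) * ε ^ j *
    A (m - (r : ℤ) - ((t - j : ℕ) : ℤ)) (n - (s : ℤ) - (j : ℤ))

/-- `g` is the coefficient function of a polynomial in two variables. -/
def IsPolyCoeff (g : ℤ → ℤ → F) : Prop :=
  {p : ℤ × ℤ | g p.1 p.2 ≠ 0}.Finite ∧ ∀ m n : ℤ, m < 0 ∨ n < 0 → g m n = 0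

/-- The coefficient function of the polynomial `h(x₁ - x₂, x₂)` in the
variables `x₁, x₂`, given the coefficient function of `h = h(x₀, x₂)`. -/
def substC (h : ℤ → ℤ → F) (m n : ℤ) : F :=
  ∑ᶠ j : ℕ, ((-1 : F) ^ j * gchoose F (m + j) j) * h (m + j) (n - j)

/-- The coefficient form of the Jacobi identity of a vertex algebra (the
Borcherds identity). -/
def VAJacobi (mul : ℤ → V →ₗ[F] V →ₗ[F] V) : Prop :=
  ∀ (a b c : ℤ) (u v w : V),
    (∑ᶠ i : ℕ, ((-1 : F) ^ i * gchoose F a i) •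
        (mul (a + b - i) u (mul (c + i) v w) -
          (-1 : F) ^ a • mul (a + c - i) v (mul (b + i) u w))) =
      ∑ᶠ i : ℕ, gchoose F b i • mul (b + c - i) (mul (a + i) u v) w

/-- The axioms of a vertex algebra: truncation, vacuum, creation and the Jacobi
identity, in coefficient form (`mul n u v` is `u_n v`). -/
def IsVA (mul : ℤ → V →ₗ[F] V →ₗ[F] V) (one : V) : Prop :=
  (∀ u v : V, ∃ N : ℤ, ∀ n : ℤ, N < n → mul n u v = 0) ∧
  (∀ v : V, mul (-1) one v = v) ∧
  (∀ n : ℤ, n ≠ -1 → ∀ v : V, mul n one v = 0) ∧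
  (∀ v : V, mul (-1) v one = v) ∧
  (∀ n : ℤ, 0 ≤ n → ∀ v : V, mul n v one = 0) ∧
  VAJacobi F mul

/-- The graded dual `V' = ⊕ₖ V₍ₖ₎*`, realized as the submodule of the full dual
consisting of functionals vanishing on all but finitely many components. -/
def gradedDual (gr : ℤ → Submodule F V) : Submodule F (Module.Dual F V) where
  carrier := {φ | ∃ s : Finset ℤ, ∀ k ∉ s, ∀ u ∈ gr k, φ u = 0}
  zero_mem' := ⟨∅, by intro k _ u _; simp⟩
  add_mem' := by
    rintro a b ⟨s, hs⟩ ⟨t, ht⟩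
    refine ⟨s ∪ t, ?_⟩
    intro k hk u hu
    simp only [Finset.mem_union, not_or] at hk
    simp [LinearMap.add_apply, hs k hk.1 u hu, ht k hk.2 u hu]
  smul_mem' := by
    rintro r a ⟨s, hs⟩
    refine ⟨s, ?_⟩
    intro k hk u hu
    simp [LinearMap.smul_apply, hs k hk u hu]

/-- The weight-`k` component `V₍ₖ₎* ⊆ V'` of the graded dual: functionals
vanishing on every component of weight other than `k`. -/
def gradedDualPiece (gr : ℤ → Submodule F V) (k : ℤ) :
    Submodule F ↥(gradedDual F gr) where
  carrier := {φ | ∀ j : ℤ, j ≠ k → ∀ u ∈ gr j, (φ : Module.Dual F V) u = 0}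
  zero_mem' := by intro j _ u _; simp
  add_mem' := by
    intro a b ha hb j hj u hu
    simp [ha j hj u hu, hb j hj u hu]
  smul_mem' := by
    intro r a ha j hj u hu
    simp [ha j hj u hu]

/-- The natural pairing of `V' ⊗ V'` with `V ⊗ V`. -/
def pairVV (gr : ℤ → Submodule F V) :
    ↥(gradedDual F gr) ⊗[F] ↥(gradedDual F gr) →ₗ[F] Module.Dual F (V ⊗[F] V) :=
  TensorProduct.dualDistrib F V V ∘ₗ
    TensorProduct.map (gradedDual F gr).subtype (gradedDual F gr).subtype

/-- The covacuum map on the graded dual: evaluation at the vacuum. -/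
def covac (gr : ℤ → Submodule F V) (one : V) : ↥(gradedDual F gr) →ₗ[F] F :=
  LinearMap.applyₗ one ∘ₗ (gradedDual F gr).subtype

/-- A bilinear form `B` on `V` extended componentwise to `V ⊗ V`. -/
def formT2 (B : V →ₗ[F] V →ₗ[F] F) : V ⊗[F] V →ₗ[F] Module.Dual F (V ⊗[F] V) :=
  TensorProduct.dualDistrib F V V ∘ₗ TensorProduct.map B B

/-- For a natural number `n`, the generalized binomial coefficient is the usual one. -/
theorem gchoose_natCast (n i : ℕ) : gchoose F (n : ℤ) i = (n.choose i : F) := by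
  have hprod : (∏ j ∈ Finset.range i, (((n : ℤ) : F) - (j : F))) = (n.descFactorial i : F) := by
    rw [← descPochhammer_eval_eq_descFactorial F n i, descPochhammer_eval_eq_prod_range]
    simp
  rw [gchoose, hprod, Nat.descFactorial_eq_factorial_mul_choose, Nat.cast_mul,
    mul_div_cancel_left₀ _ (Nat.cast_ne_zero.mpr i.factorial_ne_zero)]

/-- A homogeneous element of `V ⊗ V` tensored with one of `M` is homogeneous in `V ⊗ (V ⊗ M)`. -/
theorem assoc_tmul_mem_grVVM {gr : ℤ → Submodule F V} {grM : ℚ → Submodule F M}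
    {r : ℤ} {q : ℚ} {u : V ⊗[F] V} (hu : u ∈ grT2 F gr r) {y : M} (hy : y ∈ grM q) :
    TensorProduct.assoc F V V M (u ⊗ₜ y) ∈ grVVM F gr grM (r + q) := by
  induction hu using Submodule.iSup_induction' with
  | mem p u hu =>
    obtain ⟨t, rfl⟩ := hu
    induction t using TensorProduct.induction_on with
    | zero => simp
    | tmul a b =>
      have hy' : y ∈ grM ((r + q : ℚ) - (p : ℤ) - ((r - p : ℤ) : ℚ)) := by
        convert hy using 2
        push_cast
        ring
      exact Submodule.mem_iSup_of_mem (p, r - p) ⟨a ⊗ₜ (b ⊗ₜ ⟨y, hy'⟩), by simp⟩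
    | add a b ha hb =>
      rw [map_add, TensorProduct.add_tmul, map_add]
      exact add_mem ha hb
  | zero => simp
  | add a b _ _ ha hb =>
    rw [TensorProduct.add_tmul, map_add]
    exact add_mem ha hb

/-- A linear map on `V ⊗ M` that kills all tensors of homogeneous elements is zero. -/
theorem linearMap_eq_zero_of_homogeneous {W : Type} [AddCommGroup W] [Module F W]
    {gr : ℤ → Submodule F V} {grM : ℚ → Submodule F M} (hgr : iSup gr = ⊤) (hgrM : iSup grM = ⊤)
    (g : V ⊗[F] M →ₗ[F] W)
    (hg : ∀ r, ∀ v ∈ gr r, ∀ q, ∀ y ∈ grM q, g (v ⊗ₜ y) = 0) : g = 0 := by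
  refine TensorProduct.ext' fun v y => ?_
  rw [LinearMap.zero_apply]
  induction (hgr ▸ Submodule.mem_top : v ∈ iSup gr) using Submodule.iSup_induction' with
  | mem r v hv =>
    induction (hgrM ▸ Submodule.mem_top : y ∈ iSup grM) using Submodule.iSup_induction' with
    | mem q y hy => exact hg r v hv q y hy
    | zero => simp
    | add a b _ _ ha hb => rw [TensorProduct.tmul_add, map_add, ha, hb, add_zero]
  | zero => simp
  | add a b _ _ ha hb => rw [TensorProduct.add_tmul, map_add, ha, hb, add_zero]

/-- An element of the graded dual kills `(Y(x₀) ⊗ Id)Y(x₂)` up to a bounded order in `x₀`,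
uniformly in the vector and in the power of `x₂`. -/
theorem exists_apply_compR_eq_zero {ΔV : ℤ → V →ₗ[F] V ⊗[F] V} {gr : ℤ → Submodule F V}
    (hgr : IsGradedVC F ΔV gr) (ΔM : ℤ → M →ₗ[F] V ⊗[F] M) {grM : ℚ → Submodule F M}
    (hgrM : iSup grM = ⊤) (hbdd : ∃ N : ℚ, ∀ q < N, grM q = ⊥)
    {f : V ⊗[F] (V ⊗[F] M) →ₗ[F] F} (hf : GradedDualVVM F gr grM f) :
    ∃ k : ℕ, 0 < k ∧ ∀ m n : ℤ, k ≤ m → ∀ w : M, f (compR F ΔV ΔM m n w) = 0 := by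
  obtain ⟨hint, ⟨N, hN⟩, hΔ⟩ := hgr
  obtain ⟨N', hN'⟩ := hbdd
  obtain ⟨s, hs⟩ := hf
  obtain ⟨B, hB⟩ := s.bddAbove
  obtain ⟨k, hk⟩ := exists_nat_gt (B - N - N')
  refine ⟨k + 1, k.succ_pos, fun m n hm w => ?_⟩
  have hzero : f ∘ₗ (TensorProduct.assoc F V V M).toLinearMap ∘ₗ
      TensorProduct.map (ΔV m) LinearMap.id = 0 := by
    refine linearMap_eq_zero_of_homogeneous F hint.submodule_iSup_eq_top hgrM _
      fun r v hv q y hy => ?_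
    rcases lt_or_ge r N with hr | hr
    · rw [hN r hr, Submodule.mem_bot] at hv
      simp [hv]
    rcases lt_or_ge q N' with hq | hq
    · rw [hN' q hq, Submodule.mem_bot] at hy
      simp [hy]
    refine hs _ (fun hmem => ?_) _ (assoc_tmul_mem_grVVM F (hΔ r m v hv) hy)
    have hle : ((r + m + 1 : ℤ) : ℚ) + q ≤ B := hB hmem
    have hr' : (N : ℚ) ≤ r := mod_cast hr
    have hm' : (k : ℚ) + 1 ≤ m := mod_cast hm
    push_cast at hle
    linarith
  exact LinearMap.congr_fun hzero (ΔM n w)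

/-- For a nonnegative exponent, the left side of the Jacobi identity is a finite sum, which is
the expression appearing in weak cocommutativity. -/
theorem finsum_jacobi_left_eq_sum (ΔM : ℤ → M →ₗ[F] V ⊗[F] M) (k : ℕ) (b c : ℤ) (w : M) :
    (∑ᶠ i : ℕ, ((-1 : F) ^ i * gchoose F (k : ℤ) i) •
        (comp12 F ΔM (k + b - i) (c + i) w -
          (-1 : F) ^ (k : ℤ) • Tfirst F (comp12 F ΔM (k + c - i) (b + i) w))) =
      ∑ j ∈ Finset.range (k + 1), ((-1 : F) ^ j * (k.choose j : F)) •
        (comp12 F ΔM (b + k - j) (c + j) w -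
          Tfirst F (comp12 F ΔM (c + j) (b + k - j) w)) := by
  rw [finsum_eq_sum_of_support_subset (s := Finset.range (k + 1))]
  · simp only [gchoose_natCast, smul_sub, Finset.sum_sub_distrib]
    congr 1
    · exact Finset.sum_congr rfl fun j _ => by rw [add_comm b]
    · rw [← Finset.sum_range_reflect]
      refine Finset.sum_congr rfl fun j hj => ?_
      have hjk : j ≤ k := Nat.lt_succ_iff.mp (Finset.mem_range.mp hj)
      rw [Nat.add_sub_cancel, Nat.choose_symm hjk, smul_smul, Nat.cast_sub hjk, zpow_natCast]
      congr 1
      · have hsq : (-1 : F) ^ (k - j) * (-1) ^ k = (-1) ^ j := by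
          rw [← pow_add, show k - j + k = 2 * (k - j) + j by omega, pow_add, pow_mul]
          simp
        rw [mul_right_comm, hsq]
      · congr 3 <;> ring
  · intro i hi
    by_contra hik
    rw [Finset.mem_coe, Finset.mem_range, not_lt] at hik
    exact hi (by simp [gchoose_natCast, Nat.choose_eq_zero_of_lt hik])

/-- Weak cocommutativity for comodules: Let `M` be a comodule
over a graded vertex coalgebra `(V, Y_V, c)`.  For every `v' ∈ (V ⊗ V ⊗ M)'`
there exists `k ∈ ℤ₊`, depending only on `v'`, such that for every `w ∈ M`,
`(x₁-x₂)^k ⟨v', (Id ⊗ Y_M(x₂))Y_M(x₁)w - (T ⊗ Id)(Id ⊗ Y_M(x₁))Y_M(x₂)w⟩ = 0`. -/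
theorem comodule_weak_cocommutativity
    (ΔV : ℤ → V →ₗ[F] V ⊗[F] V) (c : V →ₗ[F] F) (gr : ℤ → Submodule F V)
    (hVC : IsVertexCoalg F ΔV c) (hgr : IsGradedVC F ΔV gr)
    (ΔM : ℤ → M →ₗ[F] V ⊗[F] M) (grM : ℚ → Submodule F M)
    (hmod : IsComoduleSansJacobi F c ΔM gr grM)
    (hJac : JacobiId F ΔV ΔM)
    (f : V ⊗[F] (V ⊗[F] M) →ₗ[F] F) (hf : GradedDualVVM F gr grM f) :
    ∃ k : ℕ, 0 < k ∧ WeakCocom F ΔM f k := by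
  obtain ⟨_, _, _, hint, hbdd, _⟩ := hmod
  obtain ⟨k, hk, hzero⟩ :=
    exists_apply_compR_eq_zero F hgr ΔM hint.submodule_iSup_eq_top hbdd hf
  refine ⟨k, hk, fun w b d => ?_⟩
  have hJ := hJac k b d w
  rw [finsum_jacobi_left_eq_sum] at hJ
  have hright : f (∑ᶠ i : ℕ, gchoose F b i • compR F ΔV ΔM (k + i) (b + d - i) w) = 0 :=
    finsum_induction (fun u => f u = 0) (map_zero f)
      (fun u v hu hv => by rw [map_add, hu, hv, add_zero])
      fun i => by rw [map_smul, hzero _ _ (by omega), smul_zero]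
  rw [← hJ] at hright
  simpa only [map_sum, map_smul, map_sub, smul_eq_mul] using hright
end
end

section
/- (Right rationality and cocommutativity for comodules.) Let (V, Y_V, c) be a graded vertex coalgebra and let M be a ℚ-graded vector space with Y_M satisfying all the axioms of a comodule over V except possibly the Jacobi identity, and additionally satisfying weak cocommutativity (for every v' ∈ (V ⊗ V ⊗ M)' there is k ∈ ℤ_+ with (x_1−x_2)^k ⟨v', (Id_V⊗Y_M(x_2))Y_M(x_1)w − (T⊗Id_M)(Id_V⊗Y_M(x_1))Y_M(x_2)w⟩ = 0 for all w). Then for every v' ∈ (V ⊗ V ⊗ M)' and w ∈ M: (a) ⟨v', (Id_V ⊗ Y_M(x_2))Y_M(x_1)w⟩ lies in F[x_1,x_2^{-1}][[x_1^{-1},x_2]] and equals ι_{12}f(x_1,x_2) for a uniquely determined f ∈ F[x_1,x_2]_S of the form g(x_1,x_2)/(x_1^r x_2^s (x_1−x_2)^t); and (b) ι_{12}^{-1}⟨v', (Id_V ⊗ Y_M(x_2))Y_M(x_1)w⟩ = ι_{21}^{-1}⟨v', (T ⊗ Id_M)(Id_V ⊗ Y_M(x_1))Y_M(x_2)w⟩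 as rational functions. -/
/- Common background for the formalization of "Vertex coalgebras, comodules,
cocommutativity and coassociativity" (K. Hubbard).

A vertex coalgebra `(V, Y, c)` is encoded by the family of coefficient maps
`Δ k : V →ₗ V ⊗ V` of the coproduct `Y(x)v = ∑ₖ Δ k v · x^(-k-1)` together with
the covacuum `c : V →ₗ F`.  All identities of formal series are encoded
coefficient-wise; in particular the Jacobi identity is encoded by its
(dual Borcherds) coefficient form. -/

noncomputable section

open scoped TensorProduct

variable (F : Type) [Field F] [CharZero F]

variable {V M : Type} [AddCommGroup V] [Module F V] [AddCommGroup M] [Module F M]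

set_option linter.unusedSectionVars false

theorem tmul_mem_grVM {gr : ℤ → Submodule F V} {grM : ℚ → Submodule F M} {p : ℤ} {q q' : ℚ}
    {v : V} {x : M} (hv : v ∈ gr p) (hx : x ∈ grM q) (h : q' = p + q) :
    v ⊗ₜ[F] x ∈ grVM F gr grM q' := by
  obtain rfl : q = q' - p := by rw [h]; ring
  exact Submodule.mem_iSup_of_mem p ⟨⟨v, hv⟩ ⊗ₜ ⟨x, hx⟩, rfl⟩

theorem tmul_tmul_mem_grVVM {gr : ℤ → Submodule F V} {grM : ℚ → Submodule F M} {p₁ p₂ : ℤ}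
    {q q' : ℚ} {u v : V} {x : M} (hu : u ∈ gr p₁) (hv : v ∈ gr p₂) (hx : x ∈ grM q)
    (h : q' = p₁ + p₂ + q) :
    u ⊗ₜ[F] (v ⊗ₜ[F] x) ∈ grVVM F gr grM q' := by
  obtain rfl : q = q' - p₁ - p₂ := by rw [h]; ring
  exact Submodule.mem_iSup_of_mem (p₁, p₂) ⟨⟨u, hu⟩ ⊗ₜ (⟨v, hv⟩ ⊗ₜ ⟨x, hx⟩), rfl⟩

/-- A submodule containing the homogeneous pure tensors contains `grVM`. -/
theorem grVM_le {gr : ℤ → Submodule F V} {grM : ℚ → Submodule F M} {q : ℚ}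
    {S : Submodule F (V ⊗[F] M)}
    (h : ∀ (p : ℤ), ∀ v ∈ gr p, ∀ x ∈ grM (q - p), v ⊗ₜ[F] x ∈ S) :
    grVM F gr grM q ≤ S := by
  refine iSup_le fun p => ?_
  rintro _ ⟨z, rfl⟩
  induction z using TensorProduct.induction_on with
  | zero => simp
  | tmul v x => exact h p v v.2 x x.2
  | add a b ha hb => rw [map_add]; exact S.add_mem ha hb

/-- A submodule containing the homogeneous pure tensors contains `grVVM`. -/
theorem grVVM_le {gr : ℤ → Submodule F V} {grM : ℚ → Submodule F M} {q : ℚ}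
    {S : Submodule F (V ⊗[F] (V ⊗[F] M))}
    (h : ∀ (p₁ p₂ : ℤ), ∀ u ∈ gr p₁, ∀ v ∈ gr p₂, ∀ x ∈ grM (q - p₁ - p₂),
      u ⊗ₜ[F] (v ⊗ₜ[F] x) ∈ S) :
    grVVM F gr grM q ≤ S := by
  refine iSup_le fun p => ?_
  rintro _ ⟨z, rfl⟩
  induction z using TensorProduct.induction_on with
  | zero => simp
  | tmul u y =>
    induction y using TensorProduct.induction_on with
    | zero => simp
    | tmul v x => exact h p.1 p.2 u u.2 v v.2 x x.2
    | add a b ha hb => rw [TensorProduct.tmul_add, map_add]; exact S.add_mem ha hb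
  | add a b ha hb => rw [map_add]; exact S.add_mem ha hb

theorem tmul_mem_grVVM {gr : ℤ → Submodule F V} {grM : ℚ → Submodule F M} {p : ℤ} {q q' : ℚ}
    {u : V} {y : V ⊗[F] M} (hu : u ∈ gr p) (hy : y ∈ grVM F gr grM q) (h : q' = p + q) :
    u ⊗ₜ[F] y ∈ grVVM F gr grM q' := by
  refine grVM_le F (S := (grVVM F gr grM q').comap (TensorProduct.mk F V (V ⊗[F] M) u)) ?_ hy
  intro p' v hv x hx
  exact tmul_tmul_mem_grVVM F hu hv hx (by rw [h]; ring)

theorem Tfirst_mem_grVVM {gr : ℤ → Submodule F V} {grM : ℚ → Submodule F M} {q : ℚ}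
    {z : V ⊗[F] (V ⊗[F] M)} (hz : z ∈ grVVM F gr grM q) :
    Tfirst F z ∈ grVVM F gr grM q := by
  refine grVVM_le F (S := (grVVM F gr grM q).comap (Tfirst F)) ?_ hz
  intro p₁ p₂ u hu v hv x hx
  exact tmul_tmul_mem_grVVM F hv hu hx (by ring)

theorem GradedDualVVM.comp_Tfirst {gr : ℤ → Submodule F V} {grM : ℚ → Submodule F M}
    {f : V ⊗[F] (V ⊗[F] M) →ₗ[F] F} (hf : GradedDualVVM F gr grM f) :
    GradedDualVVM F gr grM (f ∘ₗ Tfirst F) := by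
  obtain ⟨s, hs⟩ := hf
  exact ⟨s, fun q hq u hu => hs q hq _ (Tfirst_mem_grVVM F hu)⟩

theorem comp12_mem_grVVM {ΔM : ℤ → M →ₗ[F] V ⊗[F] M} {gr : ℤ → Submodule F V}
    {grM : ℚ → Submodule F M}
    (h : ∀ (j : ℚ) (k : ℤ), ∀ w ∈ grM j, ΔM k w ∈ grVM F gr grM (j + k + 1))
    {j : ℚ} {w : M} (hw : w ∈ grM j) (m n : ℤ) :
    comp12 F ΔM m n w ∈ grVVM F gr grM (j + m + n + 2) := by
  refine grVM_le F (S := (grVVM F gr grM (j + m + n + 2)).comap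
    (TensorProduct.map LinearMap.id (ΔM n))) ?_ (h j m w hw)
  intro p v hv x hx
  exact tmul_mem_grVVM F hv (h _ n x hx) (by ring)

/-- A functional in the graded dual kills the coefficients of the iterated coproduct of large
total index. -/
theorem exists_forall_comp12_eq_zero {ΔM : ℤ → M →ₗ[F] V ⊗[F] M} {gr : ℤ → Submodule F V}
    {grM : ℚ → Submodule F M} (hint : DirectSum.IsInternal grM)
    (h : ∀ (j : ℚ) (k : ℤ), ∀ w ∈ grM j, ΔM k w ∈ grVM F gr grM (j + k + 1))
    {f : V ⊗[F] (V ⊗[F] M) →ₗ[F] F} (hf : GradedDualVVM F gr grM f) (w : M) :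
    ∃ K : ℤ, ∀ m n : ℤ, K < m + n → f (comp12 F ΔM m n w) = 0 := by
  obtain ⟨s, hs⟩ := hf
  have hw : w ∈ ⨆ j, grM j := by rw [hint.submodule_iSup_eq_top]; trivial
  induction hw using Submodule.iSup_induction' with
  | mem j w hw =>
    obtain ⟨C, hC⟩ := s.bddAbove
    refine ⟨⌈C - j - 2⌉, fun m n hmn => hs _ (fun hmem => ?_) _ (comp12_mem_grVVM F h hw m n)⟩
    have h₁ := hC hmem
    have h₂ : C - j - 2 < ((m + n : ℤ) : ℚ) := (Int.le_ceil _).trans_lt (Int.cast_lt.mpr hmn)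
    push_cast at h₂
    linarith
  | zero => exact ⟨0, by simp⟩
  | add x y _ _ hx hy =>
    obtain ⟨K, hK⟩ := hx
    obtain ⟨L, hL⟩ := hy
    refine ⟨max K L, fun m n hmn => ?_⟩
    rw [map_add, map_add, hK m n (by omega), hL m n (by omega), add_zero]

theorem mulPoly_comm (r s t r' s' t' : ℕ) (ε : F) (A : ℤ → ℤ → F) (m n : ℤ) :
    mulPoly F r s t ε (mulPoly F r' s' t' ε A) m n =
      mulPoly F r' s' t' ε (mulPoly F r s t ε A) m n := by
  simp only [mulPoly, Finset.mul_sum]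
  rw [Finset.sum_comm]
  refine Finset.sum_congr rfl fun i _ => Finset.sum_congr rfl fun j _ => ?_
  rw [show m - r - ((t - j : ℕ) : ℤ) - r' - ((t' - i : ℕ) : ℤ) =
      m - r' - ((t' - i : ℕ) : ℤ) - r - ((t - j : ℕ) : ℤ) by ring,
    show n - s - (j : ℤ) - s' - (i : ℤ) = n - s' - i - s - j by ring]
  ring

theorem mulPoly_eq_zero {r s t : ℕ} {ε : F} {A : ℤ → ℤ → F} {m n : ℤ}
    (h : ∀ j ≤ t, A (m - r - ((t - j : ℕ) : ℤ)) (n - s - (j : ℤ)) = 0) :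
    mulPoly F r s t ε A m n = 0 := by
  refine Finset.sum_eq_zero fun j hj => ?_
  rw [h j (Finset.mem_range_succ_iff.mp hj), mul_zero]

/-- If two series with opposite support cones agree after multiplication by a power of
`x₁ - x₂`, then the common product is, up to a monomial, a polynomial. -/
theorem isPolyCoeff_mulPoly {A B : ℤ → ℤ → F} {N t : ℕ} {ε : F}
    (hA : ∀ m n : ℤ, ((N : ℤ) < m ∨ n < -(N : ℤ)) → A m n = 0)
    (hB : ∀ m n : ℤ, (m < -(N : ℤ) ∨ (N : ℤ) < n) → B m n = 0)
    (hAB : ∀ m n : ℤ, mulPoly F N N t ε A m n = mulPoly F N N t ε B m n) :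
    IsPolyCoeff F (mulPoly F N N t ε A) := by
  have hneg : ∀ m n : ℤ, m < 0 ∨ n < 0 → mulPoly F N N t ε A m n = 0 := by
    rintro m n (hm | hn)
    · rw [hAB]
      exact mulPoly_eq_zero F fun j _ => hB _ _ (Or.inl (by omega))
    · exact mulPoly_eq_zero F fun j _ => hA _ _ (Or.inr (by omega))
  refine ⟨(Set.finite_Icc ((0, 0) : ℤ × ℤ) (2 * N + t, 2 * N + t)).subset ?_, hneg⟩
  rintro ⟨m, n⟩ hmn
  have hm₀ : 0 ≤ m := by
    by_contra! hm
    exact hmn (hneg m n (Or.inl hm))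
  have hn₀ : 0 ≤ n := by
    by_contra! hn
    exact hmn (hneg m n (Or.inr hn))
  have hm : m ≤ 2 * N + t := by
    by_contra! hm
    exact hmn (mulPoly_eq_zero F fun j _ => hA _ _ (Or.inl (by omega)))
  have hn : n ≤ 2 * N + t := by
    by_contra! hn
    refine hmn ((hAB m n).trans ?_)
    exact mulPoly_eq_zero F fun j _ => hB _ _ (Or.inr (by omega))
  exact ⟨⟨hm₀, hn₀⟩, hm, hn⟩

/-- Weak cocommutativity in terms of `mulPoly`. -/
theorem WeakCocom.mulPoly_eq {ΔM : ℤ → M →ₗ[F] V ⊗[F] M}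
    {f : V ⊗[F] (V ⊗[F] M) →ₗ[F] F} {k : ℕ} (h : WeakCocom F ΔM f k) (w : M) (r s : ℕ)
    (m n : ℤ) :
    mulPoly F r s k (-1) (fun m n => f (comp12 F ΔM (-m - 1) (-n - 1) w)) m n =
      mulPoly F r s k (-1) (fun m n => f (Tfirst F (comp12 F ΔM (-n - 1) (-m - 1) w))) m n := by
  rw [← sub_eq_zero, mulPoly, mulPoly, ← Finset.sum_sub_distrib,
    ← h w (-m + r - 1) (-n + s - 1)]
  refine Finset.sum_congr rfl fun j hj => ?_
  have hjk := Finset.mem_range_succ_iff.mp hj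
  rw [← mul_sub, mul_comm ((k.choose j : F)),
    show -(m - r - ((k - j : ℕ) : ℤ)) - 1 = -m + r - 1 + k - j by omega,
    show -(n - s - (j : ℤ)) - 1 = -n + s - 1 + j by omega]

/-- Right rationality and cocommutativity for comodules: Let `M`
satisfy all the axioms of a comodule over a graded vertex coalgebra `(V, Y_V, c)`
except possibly the Jacobi identity, together with weak cocommutativity.  Then
for every `v' ∈ (V ⊗ V ⊗ M)'` and `w ∈ M`:
(a) `⟨v', (Id ⊗ Y_M(x₂))Y_M(x₁)w⟩` lies in `F[x₁,x₂⁻¹][[x₁⁻¹,x₂]]` and equals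
`ι₁₂ f` for a uniquely determined rational function `f = g/(x₁^r x₂^s (x₁-x₂)^t)`;
(b) `ι₁₂⁻¹⟨v', (Id ⊗ Y_M(x₂))Y_M(x₁)w⟩ = ι₂₁⁻¹⟨v', (T ⊗ Id)(Id ⊗ Y_M(x₁))Y_M(x₂)w⟩`.
Rendered coefficient-wise as in the algebra case. -/
theorem comodule_right_rationality_and_cocommutativity
    (ΔV : ℤ → V →ₗ[F] V ⊗[F] V) (c : V →ₗ[F] F) (gr : ℤ → Submodule F V)
    (hVC : IsVertexCoalg F ΔV c) (hgr : IsGradedVC F ΔV gr)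
    (ΔM : ℤ → M →ₗ[F] V ⊗[F] M) (grM : ℚ → Submodule F M)
    (hmod : IsComoduleSansJacobi F c ΔM gr grM)
    (hwcom : ∀ (f : V ⊗[F] (V ⊗[F] M) →ₗ[F] F), GradedDualVVM F gr grM f →
      ∃ k : ℕ, 0 < k ∧ WeakCocom F ΔM f k)
    (f : V ⊗[F] (V ⊗[F] M) →ₗ[F] F) (hf : GradedDualVVM F gr grM f) (w : M)
    (A : ℤ → ℤ → F) (hA : A = fun m n => f (comp12 F ΔM (-m - 1) (-n - 1) w))
    (B : ℤ → ℤ → F) (hB : B = fun m n => f (Tfirst F (comp12 F ΔM (-n - 1) (-m - 1) w))) :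
    (∃ N : ℤ, ∀ m n : ℤ, (N < m → A m n = 0) ∧ (n < -N → A m n = 0)) ∧
    ∃ (g : ℤ → ℤ → F) (r s t : ℕ), IsPolyCoeff F g ∧
      (∀ m n : ℤ, mulPoly F r s t (-1) A m n = g m n) ∧
      (∀ m n : ℤ, mulPoly F r s t (-1) B m n = g m n) ∧
      (∀ (g' : ℤ → ℤ → F) (r' s' t' : ℕ), IsPolyCoeff F g' →
        (∀ m n : ℤ, mulPoly F r' s' t' (-1) A m n = g' m n) →
        ∀ m n : ℤ, mulPoly F r' s' t' (-1) g m n = mulPoly F r s t (-1) g' m n) := by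
  obtain ⟨-, -, htrunc, hint, -, hdeg⟩ := hmod
  obtain ⟨k, -, hk⟩ := hwcom f hf
  obtain ⟨L, hL⟩ := htrunc w
  obtain ⟨K, hK⟩ := exists_forall_comp12_eq_zero F hint hdeg hf w
  obtain ⟨K', hK'⟩ := exists_forall_comp12_eq_zero F hint hdeg (hf.comp_Tfirst F) w
  have hcomp : ∀ m n : ℤ, m < L → comp12 F ΔM m n w = 0 := fun m n hm => by
    simp [comp12, hL m hm]
  obtain ⟨N, hN⟩ : ∃ N : ℕ, N = L.natAbs + K.natAbs + K'.natAbs + 2 := ⟨_, rfl⟩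
  have hA₀ : ∀ m n : ℤ, ((N : ℤ) < m ∨ n < -(N : ℤ)) → A m n = 0 := by
    intro m n hmn
    rw [hA]
    by_cases hm : -m - 1 < L
    · simp [hcomp _ _ hm]
    · exact hK _ _ (by omega)
  have hB₀ : ∀ m n : ℤ, (m < -(N : ℤ) ∨ (N : ℤ) < n) → B m n = 0 := by
    intro m n hmn
    rw [hB]
    by_cases hn : -n - 1 < L
    · simp [hcomp _ _ hn]
    · exact hK' _ _ (by omega)
  have hAB : ∀ m n : ℤ, mulPoly F N N k (-1) A m n = mulPoly F N N k (-1) B m n := by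
    rw [hA, hB]
    exact hk.mulPoly_eq F w N N
  refine ⟨⟨N, fun m n => ⟨fun h => hA₀ m n (Or.inl h), fun h => hA₀ m n (Or.inr h)⟩⟩,
    mulPoly F N N k (-1) A, N, N, k, isPolyCoeff_mulPoly F hA₀ hB₀ hAB, fun _ _ => rfl,
    fun m n => (hAB m n).symm, ?_⟩
  intro g' r' s' t' _ hg' m n
  obtain rfl : mulPoly F r' s' t' (-1) A = g' := funext₂ hg'
  exact mulPoly_comm F r' s' t' N N k (-1) A m n
end
end

section
/- Let (V, Y_V, c) be a graded vertex coalgebra and let M be a ℚ-graded vector space with a map Y_M satisfying all the axioms of a comodule over V except possibly the Jacobi identity. If M satisfies weak coassociativity (for every v' ∈ (V ⊗ V ⊗ M)' there exists k ∈ ℤ_+, independent of w, such that (x_0+x_2)^k ⟨v', (Y_V(x_0) ⊗ Id_M)Y_M(x_2)w − (Id_V ⊗ Y_M(x_2))Y_M(x_0 + x_2)w⟩ = 0 for all w ∈ M), then Y_M satisfies the comodule Jacobi identity, so M is a comodule over the graded vertex coalgebra V. -/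
/- Common background for the formalization of "Vertex coalgebras, comodules,
cocommutativity and coassociativity" (K. Hubbard).

A vertex coalgebra `(V, Y, c)` is encoded by the family of coefficient maps
`Δ k : V →ₗ V ⊗ V` of the coproduct `Y(x)v = ∑ₖ Δ k v · x^(-k-1)` together with
the covacuum `c : V →ₗ F`.  All identities of formal series are encoded
coefficient-wise; in particular the Jacobi identity is encoded by its
(dual Borcherds) coefficient form. -/

noncomputable section

open scoped TensorProduct

variable (F : Type) [Field F] [CharZero F]

variable {V M : Type} [AddCommGroup V] [Module F V] [AddCommGroup M] [Module F M]

set_option linter.unusedSectionVars false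

section FormalSums

variable {F}

lemma gchoose_zero_right (a : ℤ) : gchoose F a 0 = 1 := by
  simp [gchoose]

lemma gchoose_zero_succ (i : ℕ) : gchoose F 0 (i + 1) = 0 := by
  simp [gchoose, Finset.prod_range_succ']

lemma gchoose_succ_succ (a : ℤ) (i : ℕ) :
    gchoose F (a + 1) (i + 1) = gchoose F a i + gchoose F a (i + 1) := by
  have h1 : (Nat.factorial i : F) ≠ 0 := Nat.cast_ne_zero.mpr (Nat.factorial_ne_zero i)
  have h2 : ((i : F) + 1) ≠ 0 := Nat.cast_add_one_ne_zero i
  have h3 : ∏ j ∈ Finset.range (i + 1), (((a + 1 : ℤ) : F) - (j : F)) =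
      ((a : F) + 1) * ∏ j ∈ Finset.range i, ((a : F) - (j : F)) := by
    rw [Finset.prod_range_succ', mul_comm]
    congr 1
    · simp
    · refine Finset.prod_congr rfl fun j _ => ?_
      push_cast
      ring
  simp only [gchoose, h3]
  rw [Finset.prod_range_succ, Nat.factorial_succ]
  push_cast
  field_simp
  ring

lemma gchoose_neg_one (i : ℕ) : gchoose F (-1) i = (-1) ^ i := by
  induction i with
  | zero => rw [gchoose_zero_right, pow_zero]
  | succ i ih =>
    have h := gchoose_succ_succ (F := F) (-1) i
    rw [show (-1 : ℤ) + 1 = 0 by norm_num, gchoose_zero_succ, ih] at h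
    rw [pow_succ]
    linear_combination -h

variable {W W' : Type} [AddCommGroup W] [Module F W] [AddCommGroup W'] [Module F W']

lemma finsum_eq_sum_range {G : ℕ → W} {N : ℕ} (h : ∀ i ≥ N, G i = 0) :
    ∑ᶠ i, G i = ∑ i ∈ Finset.range N, G i := by
  refine finsum_eq_sum_of_support_subset G fun i hi => ?_
  by_contra hiN
  exact hi (h i (by simpa using hiN))

lemma finite_support_of_eventually {G : ℕ → W} (h : ∀ᶠ i in Filter.atTop, G i = 0) :
    G.support.Finite := by
  obtain ⟨N, hN⟩ := Filter.eventually_atTop.mp h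
  refine (Finset.range N).finite_toSet.subset fun i hi => ?_
  by_contra hiN
  exact hi (hN i (by simpa using hiN))

lemma finsum_sub_of_eventually {G H : ℕ → W} (hG : ∀ᶠ i in Filter.atTop, G i = 0)
    (hH : ∀ᶠ i in Filter.atTop, H i = 0) : ∑ᶠ i, (G i - H i) = ∑ᶠ i, G i - ∑ᶠ i, H i :=
  finsum_sub_distrib (finite_support_of_eventually hG) (finite_support_of_eventually hH)

lemma map_finsum_of_eventually (L : W →ₗ[F] W') {G : ℕ → W}
    (h : ∀ᶠ i in Filter.atTop, G i = 0) : L (∑ᶠ i, G i) = ∑ᶠ i, L (G i) :=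
  L.toAddMonoidHom.map_finsum (finite_support_of_eventually h)

lemma smul_finsum_of_eventually (r : F) {G : ℕ → W}
    (h : ∀ᶠ i in Filter.atTop, G i = 0) : r • ∑ᶠ i, G i = ∑ᶠ i, r • G i :=
  map_finsum_of_eventually (LinearMap.lsmul F W r) h

lemma finsum_gchoose_succ (a : ℤ) {G : ℕ → W} (h : ∀ᶠ i in Filter.atTop, G i = 0) :
    ∑ᶠ i, gchoose F (a + 1) i • G i =
      ∑ᶠ i, gchoose F a i • G i + ∑ᶠ i, gchoose F a i • G (i + 1) := by
  obtain ⟨N, hN⟩ := Filter.eventually_atTop.mp h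
  rw [finsum_eq_sum_range (N := N + 1) fun i hi => by rw [hN i (by omega), smul_zero],
    finsum_eq_sum_range (N := N + 1) fun i hi => by rw [hN i (by omega), smul_zero],
    finsum_eq_sum_range (N := N) fun i hi => by rw [hN (i + 1) (by omega), smul_zero],
    Finset.sum_range_succ', Finset.sum_range_succ' (fun i => gchoose F a i • G i)]
  simp only [gchoose_succ_succ, gchoose_zero_right, add_smul, Finset.sum_add_distrib]
  abel

lemma finsum_gchoose_zero (G : ℕ → W) : ∑ᶠ i, gchoose F 0 i • G i = G 0 := by
  rw [finsum_eq_sum_range (N := 1) fun i hi => ?_]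
  · simp [gchoose_zero_right]
  · obtain ⟨j, rfl⟩ : ∃ j, i = j + 1 := ⟨i - 1, by omega⟩
    rw [gchoose_zero_succ, zero_smul]

/-- `A m n` vanishes when its first index is sufficiently small. -/
def TruncFst (A : ℤ → ℤ → W) : Prop := ∃ N : ℤ, ∀ m < N, ∀ n, A m n = 0

/-- `C m n` vanishes when its second index is sufficiently small. -/
def TruncSnd (C : ℤ → ℤ → W) : Prop := ∃ N : ℤ, ∀ n < N, ∀ m, C m n = 0

lemma TruncFst.map {A : ℤ → ℤ → W} (hA : TruncFst A) (L : W →ₗ[F] W') :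
    TruncFst fun m n => L (A m n) := by
  obtain ⟨N, hN⟩ := hA
  exact ⟨N, fun m hm n => by simp only [hN m hm, map_zero]⟩

lemma TruncSnd.map {C : ℤ → ℤ → W} (hC : TruncSnd C) (L : W →ₗ[F] W') :
    TruncSnd fun m n => L (C m n) := by
  obtain ⟨N, hN⟩ := hC
  exact ⟨N, fun n hn m => by simp only [hN n hn, map_zero]⟩

lemma TruncFst.eventually {A : ℤ → ℤ → W} (hA : TruncFst A) (s : ℤ) (t : ℕ → ℤ) :
    ∀ᶠ i : ℕ in Filter.atTop, A (s - i) (t i) = 0 := by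
  obtain ⟨N, hN⟩ := hA
  filter_upwards [Filter.eventually_gt_atTop (s - N).toNat] with i hi
  exact hN _ (by omega) _

lemma TruncSnd.eventually {C : ℤ → ℤ → W} (hC : TruncSnd C) (s : ℤ) (t : ℕ → ℤ) :
    ∀ᶠ i : ℕ in Filter.atTop, C (t i) (s - i) = 0 := by
  obtain ⟨N, hN⟩ := hC
  filter_upwards [Filter.eventually_gt_atTop (s - N).toNat] with i hi
  exact hN _ (by omega) _

variable (F)

/-- The coefficient of `x₀^(-a-1) x₁^(-b-1) x₂^(-c-1)` in `x₀⁻¹δ((x₁-x₂)/x₀) A(x₁, x₂)`, where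
`A m n` is the coefficient of `x₁^(-m-1) x₂^(-n-1)` in `A(x₁, x₂)`. -/
def deltaDiff (A : ℤ → ℤ → W) (a b c : ℤ) : W :=
  ∑ᶠ i : ℕ, gchoose F a i • (-1 : F) ^ i • A (a + b - i) (c + i)

/-- The coefficient of `x₀^(-a-1) x₁^(-b-1) x₂^(-c-1)` in `x₂⁻¹δ((x₁-x₀)/x₂) C(x₀, x₂)`, where
`C m n` is the coefficient of `x₀^(-m-1) x₂^(-n-1)` in `C(x₀, x₂)`. -/
def deltaIter (C : ℤ → ℤ → W) (a b c : ℤ) : W :=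
  ∑ᶠ i : ℕ, gchoose F b i • C (a + i) (b + c - i)

/-- The coefficient of `x₀^(-a-1) x₁^(-b-1) x₂^(-c-1)` in the difference of the two sides of a
Jacobi identity with composites `A` and `B` and iterate `C`. -/
def jacobiDefect (A B C : ℤ → ℤ → W) (a b c : ℤ) : W :=
  deltaDiff F A a b c - (-1 : F) ^ a • deltaDiff F B a c b - deltaIter F C a b c

variable {F}

lemma map_deltaDiff (L : W →ₗ[F] W') {A : ℤ → ℤ → W} (hA : TruncFst A) (a b c : ℤ) :
    L (deltaDiff F A a b c) = deltaDiff F (fun m n => L (A m n)) a b c := by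
  rw [deltaDiff, map_finsum_of_eventually]
  · simp [deltaDiff]
  · filter_upwards [hA.eventually (a + b) fun i => c + i] with i hi
    simp [hi]

lemma map_deltaIter (L : W →ₗ[F] W') {C : ℤ → ℤ → W} (hC : TruncSnd C) (a b c : ℤ) :
    L (deltaIter F C a b c) = deltaIter F (fun m n => L (C m n)) a b c := by
  rw [deltaIter, map_finsum_of_eventually]
  · simp [deltaIter]
  · filter_upwards [hC.eventually (b + c) fun i => a + i] with i hi
    simp [hi]

lemma map_jacobiDefect (L : W →ₗ[F] W') {A B C : ℤ → ℤ → W} (hA : TruncFst A)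
    (hB : TruncFst B) (hC : TruncSnd C) (a b c : ℤ) :
    L (jacobiDefect F A B C a b c) = jacobiDefect F (fun m n => L (A m n))
      (fun m n => L (B m n)) (fun m n => L (C m n)) a b c := by
  simp only [jacobiDefect, map_sub, map_smul, map_deltaDiff L hA, map_deltaDiff L hB,
    map_deltaIter L hC]

/-- The recursion expressing `(x₁ - x₂) X = x₀ X` in terms of coefficients. -/
def DeltaRec (X : ℤ → ℤ → ℤ → W) : Prop :=
  ∀ a b c, X (a + 1) b c = X a (b + 1) c - X a b (c + 1)

lemma deltaDiff_rec {A : ℤ → ℤ → W} (hA : TruncFst A) : DeltaRec (deltaDiff F A) := by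
  intro a b c
  simp only [deltaDiff]
  rw [finsum_gchoose_succ, sub_eq_add_neg, ← finsum_neg_distrib]
  · congr 1
    · refine finsum_congr fun i => ?_
      rw [show a + 1 + b - i = a + (b + 1) - (i : ℤ) by ring]
    · refine finsum_congr fun i => ?_
      rw [show a + 1 + b - ((i + 1 : ℕ) : ℤ) = a + b - (i : ℤ) by push_cast; ring,
        show c + ((i + 1 : ℕ) : ℤ) = c + 1 + i by push_cast; ring, pow_succ]
      simp
  · filter_upwards [hA.eventually (a + 1 + b) fun i => c + i] with i hi
    simp [hi]

lemma deltaIter_rec {C : ℤ → ℤ → W} (hC : TruncSnd C) : DeltaRec (deltaIter F C) := by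
  intro a b c
  simp only [deltaIter]
  rw [finsum_gchoose_succ, eq_sub_iff_add_eq, add_comm]
  · congr 1
    · refine finsum_congr fun i => ?_
      rw [show b + 1 + c - i = b + (c + 1) - (i : ℤ) by ring]
    · refine finsum_congr fun i => ?_
      rw [show b + 1 + c - ((i + 1 : ℕ) : ℤ) = b + c - (i : ℤ) by push_cast; ring,
        show a + ((i + 1 : ℕ) : ℤ) = a + 1 + i by push_cast; ring]
  · exact hC.eventually (b + 1 + c) fun i => a + i

lemma DeltaRec.swap {X : ℤ → ℤ → ℤ → W} (hX : DeltaRec X) :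
    DeltaRec fun a b c => (-1 : F) ^ a • X a c b := by
  intro a b c
  simp only [hX a c b, zpow_add_one₀ (neg_ne_zero.mpr (one_ne_zero (α := F)))]
  module

lemma DeltaRec.sub {X Y : ℤ → ℤ → ℤ → W} (hX : DeltaRec X) (hY : DeltaRec Y) :
    DeltaRec fun a b c => X a b c - Y a b c := by
  intro a b c
  simp only [hX a b c, hY a b c]
  abel

lemma DeltaRec.map {X : ℤ → ℤ → ℤ → W} (hX : DeltaRec X) (L : W →ₗ[F] W') :
    DeltaRec fun a b c => L (X a b c) := by
  intro a b c
  simp only [hX a b c, map_sub]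

lemma jacobiDefect_rec {A B C : ℤ → ℤ → W} (hA : TruncFst A) (hB : TruncFst B)
    (hC : TruncSnd C) : DeltaRec (jacobiDefect F A B C) :=
  ((deltaDiff_rec hA).sub (deltaDiff_rec hB).swap).sub (deltaIter_rec hC)

lemma DeltaRec.eq_zero_of_le {X : ℤ → ℤ → ℤ → W} (hX : DeltaRec X) {k : ℤ}
    (hk : ∀ a c, X a k c = 0) {b : ℤ} (hb : k ≤ b) : ∀ a c, X a b c = 0 := by
  induction b, hb using Int.leInduction with
  | base => exact hk
  | succ b _ ih =>
    intro a c
    have h := hX a b c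
    rw [ih, ih, sub_zero] at h
    exact h.symm

/-- A solution of the recursion vanishing on a plane `b = k` and somewhere on each line on which
`b` and `a + c` are constant vanishes identically. -/
lemma DeltaRec.eq_zero {X : ℤ → ℤ → ℤ → W} (hX : DeltaRec X) {k : ℤ}
    (hk : ∀ a c, X a k c = 0) (hline : ∀ a b c, ∃ t, X (a + t) b (c - t) = 0) :
    ∀ a b c, X a b c = 0 := by
  intro a b
  rcases le_total k b with hb | hb
  · exact hX.eq_zero_of_le hk hb a
  induction b, hb using Int.leInductionDown generalizing a with
  | base => exact hk a
  | pred b _ ih =>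
    intro c
    have step : ∀ a c, X (a + 1) (b - 1) c = - X a (b - 1) (c + 1) := fun a c => by
      rw [hX a (b - 1) c, sub_add_cancel, ih, zero_sub]
    have shift : ∀ t : ℤ, X (a + t) (b - 1) (c - t) = 0 ↔ X a (b - 1) c = 0 := by
      intro t
      induction t using Int.induction_on with
      | zero => simp
      | succ t ih =>
        rw [← ih, ← add_assoc, step, neg_eq_zero, show c - ((t : ℤ) + 1) + 1 = c - t by ring]
      | pred t ih =>
        rw [← ih, ← neg_eq_zero, show c - (-(t : ℤ) - 1) = c - -(t : ℤ) + 1 by ring, ← step,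
          show a + (-(t : ℤ) - 1) + 1 = a + -(t : ℤ) by ring]
    obtain ⟨t, ht⟩ := hline a (b - 1) c
    exact (shift t).mp ht

/-- Moving up `k` planes by the recursion amounts to multiplying by `(x₀ + x₂)^k`. -/
lemma DeltaRec.sum_choose {X : ℤ → ℤ → ℤ → W} (hX : DeltaRec X) (k : ℕ) (b a c : ℤ) :
    X a (b + k) c =
      ∑ j ∈ Finset.range (k + 1), (k.choose j : F) • X (a + k - j) b (c + j) := by
  induction k generalizing b with
  | zero => simp
  | succ k ih =>
    rw [show b + ((k + 1 : ℕ) : ℤ) = b + 1 + k by push_cast; ring, ih,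
      Finset.sum_range_succ' _ (k + 1)]
    have h : ∀ a c, X a (b + 1) c = X (a + 1) b c + X a b (c + 1) := fun a c => by
      rw [hX a b c, sub_add_cancel]
    simp only [h, smul_add, Finset.sum_add_distrib, Nat.choose_succ_succ, Nat.cast_add, add_smul]
    rw [Finset.sum_range_succ (fun j => ((k.choose (j + 1) : ℕ) : F) • _) k,
      Finset.sum_range_succ' (fun j => (k.choose j : F) • X (a + k - j + 1) b (c + j)) k]
    have e1 : ∀ j : ℤ, a + (k : ℤ) + 1 - (j + 1) = a + k - j := fun j => by ring
    have e2 : ∀ j : ℤ, a + (k : ℤ) - (j + 1) + 1 = a + k - j := fun j => by ring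
    simp only [Nat.choose_succ_self, Nat.cast_zero, zero_smul, add_zero, Nat.choose_zero_right,
      Nat.cast_add, Nat.cast_one, e1, e2, sub_zero, ← add_assoc]
    abel

end FormalSums

section Projections

variable {F} {X Y Z : Type} [AddCommGroup X] [Module F X] [AddCommGroup Y] [Module F Y]
  [AddCommGroup Z] [Module F Z] {ι κ η : Type}

/-- Every vector is the sum of its images under sufficiently large finite subfamilies of `P`. -/
def Resolves (P : ι → X →ₗ[F] X) : Prop :=
  ∀ x, ∃ s : Finset ι, ∀ t, s ⊆ t → ∑ i ∈ t, P i x = x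

lemma Resolves.eq_zero {P : ι → X →ₗ[F] X} (hP : Resolves P) {x : X} (hx : ∀ i, P i x = 0) :
    x = 0 := by
  obtain ⟨s, hs⟩ := hP x
  rw [← hs s subset_rfl, Finset.sum_eq_zero fun i _ => hx i]

lemma Resolves.of_add {P : ι → X →ₗ[F] X} {x y : X}
    (hx : ∃ s : Finset ι, ∀ t, s ⊆ t → ∑ i ∈ t, P i x = x)
    (hy : ∃ s : Finset ι, ∀ t, s ⊆ t → ∑ i ∈ t, P i y = y) :
    ∃ s : Finset ι, ∀ t, s ⊆ t → ∑ i ∈ t, P i (x + y) = x + y := by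
  classical
  obtain ⟨s, hs⟩ := hx
  obtain ⟨s', hs'⟩ := hy
  refine ⟨s ∪ s', fun t ht => ?_⟩
  simp only [map_add, Finset.sum_add_distrib]
  rw [hs t (Finset.union_subset_left ht), hs' t (Finset.union_subset_right ht)]

lemma Resolves.map_left {P : ι → X →ₗ[F] X} (hP : Resolves P) :
    Resolves fun i => TensorProduct.map (P i) (LinearMap.id : Y →ₗ[F] Y) := by
  intro u
  induction u using TensorProduct.induction_on with
  | zero => exact ⟨∅, by simp⟩
  | tmul x y =>
    obtain ⟨s, hs⟩ := hP x
    exact ⟨s, fun t ht => by simp [← TensorProduct.sum_tmul, hs t ht]⟩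
  | add x y hx hy => exact Resolves.of_add hx hy

lemma Resolves.map_right {P : ι → X →ₗ[F] X} (hP : Resolves P) :
    Resolves fun i => TensorProduct.map (LinearMap.id : Y →ₗ[F] Y) (P i) := by
  intro u
  induction u using TensorProduct.induction_on with
  | zero => exact ⟨∅, by simp⟩
  | tmul x y =>
    obtain ⟨s, hs⟩ := hP y
    exact ⟨s, fun t ht => by simp [← TensorProduct.tmul_sum, hs t ht]⟩
  | add x y hx hy => exact Resolves.of_add hx hy

lemma Resolves.tensor_eq_zero {P : ι → X →ₗ[F] X} {Q : κ → Y →ₗ[F] Y} (hP : Resolves P)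
    (hQ : Resolves Q) {u : X ⊗[F] Y} (hu : ∀ i j, TensorProduct.map (P i) (Q j) u = 0) :
    u = 0 := by
  refine (hP.map_left (Y := Y)).eq_zero fun i => (hQ.map_right (Y := X)).eq_zero fun j => ?_
  rw [← LinearMap.comp_apply, ← TensorProduct.map_comp]
  exact hu i j

lemma Resolves.tensor_tensor_eq_zero {P : ι → X →ₗ[F] X} {Q : κ → Y →ₗ[F] Y}
    {R : η → Z →ₗ[F] Z} (hP : Resolves P) (hQ : Resolves Q) (hR : Resolves R)
    {u : X ⊗[F] (Y ⊗[F] Z)}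
    (hu : ∀ i j k, TensorProduct.map (P i) (TensorProduct.map (Q j) (R k)) u = 0) : u = 0 := by
  refine (hP.map_left (Y := Y ⊗[F] Z)).eq_zero fun i =>
    ((hQ.map_left (Y := Z)).map_right (Y := X)).eq_zero fun j =>
    ((hR.map_right (Y := Y)).map_right (Y := X)).eq_zero fun k => ?_
  rw [← LinearMap.comp_apply, ← LinearMap.comp_apply, ← TensorProduct.map_comp,
    ← TensorProduct.map_comp, ← TensorProduct.map_comp]
  exact hu i j k

variable [DecidableEq ι]

/-- The projection onto the `p`-th component of an internal direct sum. -/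
def gradedProj {gr : ι → Submodule F X} (h : DirectSum.IsInternal gr) (p : ι) : X →ₗ[F] X :=
  (gr p).subtype ∘ₗ DirectSum.component F ι (fun i => gr i) p ∘ₗ
    (LinearEquiv.ofBijective (DirectSum.coeLinearMap gr) h).symm.toLinearMap

variable {gr : ι → Submodule F X} (h : DirectSum.IsInternal gr)

lemma gradedProj_of_mem {p : ι} {x : X} (hx : x ∈ gr p) : gradedProj h p x = x :=
  congrArg Subtype.val (h.ofBijective_coeLinearMap_of_mem hx)

lemma gradedProj_of_mem_ne {p q : ι} (hpq : q ≠ p) {x : X} (hx : x ∈ gr q) :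
    gradedProj h p x = 0 :=
  congrArg Subtype.val (h.ofBijective_coeLinearMap_of_mem_ne hpq hx)

lemma gradedProj_comp_subtype_of_ne {p q : ι} (hpq : q ≠ p) :
    gradedProj h p ∘ₗ (gr q).subtype = 0 := by
  ext x
  exact gradedProj_of_mem_ne h hpq x.2

include h in
lemma linearMap_eq_zero_of_graded {f : X →ₗ[F] Y} (hf : ∀ p, ∀ x ∈ gr p, f x = 0) : f = 0 := by
  have : ⨆ p, gr p ≤ LinearMap.ker f := iSup_le fun p x hx => hf p x hx
  rw [h.submodule_iSup_eq_top] at this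
  exact LinearMap.ker_eq_top.mp (top_le_iff.mp this)

lemma resolves_gradedProj : Resolves (gradedProj h) := by
  intro x
  have hx : x ∈ ⨆ p, gr p := h.submodule_iSup_eq_top ▸ Submodule.mem_top
  induction hx using Submodule.iSup_induction' with
  | mem p x hx =>
    refine ⟨{p}, fun t ht => ?_⟩
    rw [Finset.sum_eq_single_of_mem p (ht (Finset.mem_singleton_self p)),
      gradedProj_of_mem h hx]
    exact fun q _ hq => gradedProj_of_mem_ne h hq.symm hx
  | zero => exact ⟨∅, by simp⟩
  | add x y _ _ hx hy => exact Resolves.of_add hx hy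

end Projections

section Gradings

variable {F} {gr : ℤ → Submodule F V} {grM : ℚ → Submodule F M}

lemma map_gradedProj_eq_zero_of_mem_grVM (hV : DirectSum.IsInternal gr)
    (hM : DirectSum.IsInternal grM) {p : ℤ} {q r : ℚ} (hq : q ≠ p + r) {u : V ⊗[F] M}
    (hu : u ∈ grVM F gr grM q) :
    TensorProduct.map (gradedProj hV p) (gradedProj hM r) u = 0 := by
  suffices grVM F gr grM q ≤
      LinearMap.ker (TensorProduct.map (gradedProj hV p) (gradedProj hM r)) from this hu
  refine iSup_le fun p' => ?_
  rw [LinearMap.range_le_ker_iff, ← TensorProduct.map_comp]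
  by_cases hp : p' = p
  · subst hp
    rw [gradedProj_comp_subtype_of_ne hM (fun h => hq (by linarith)), TensorProduct.map_zero_right]
  · rw [gradedProj_comp_subtype_of_ne hV hp, TensorProduct.map_zero_left]

lemma map_gradedProj_eq_zero_of_mem_grVVM (hV : DirectSum.IsInternal gr)
    (hM : DirectSum.IsInternal grM) {p₁ p₂ : ℤ} {q r : ℚ} (hq : q ≠ p₁ + p₂ + r)
    {u : V ⊗[F] (V ⊗[F] M)} (hu : u ∈ grVVM F gr grM q) :
    TensorProduct.map (gradedProj hV p₁)
      (TensorProduct.map (gradedProj hV p₂) (gradedProj hM r)) u = 0 := by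
  suffices grVVM F gr grM q ≤ LinearMap.ker (TensorProduct.map (gradedProj hV p₁)
      (TensorProduct.map (gradedProj hV p₂) (gradedProj hM r))) from this hu
  refine iSup_le fun ⟨p₁', p₂'⟩ => ?_
  rw [LinearMap.range_le_ker_iff, ← TensorProduct.map_comp, ← TensorProduct.map_comp]
  by_cases hp₁ : p₁' = p₁
  · by_cases hp₂ : p₂' = p₂
    · subst hp₁ hp₂
      rw [gradedProj_comp_subtype_of_ne hM (fun h => hq (by dsimp only at h; linarith)),
        TensorProduct.map_zero_right, TensorProduct.map_zero_right]
    · rw [gradedProj_comp_subtype_of_ne hV hp₂, TensorProduct.map_zero_left,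
        TensorProduct.map_zero_right]
  · rw [gradedProj_comp_subtype_of_ne hV hp₁, TensorProduct.map_zero_left]

lemma gradedDualVVM_comp_gradedProj (hV : DirectSum.IsInternal gr)
    (hM : DirectSum.IsInternal grM) (p₁ p₂ : ℤ) (r : ℚ) (g : V ⊗[F] (V ⊗[F] M) →ₗ[F] F) :
    GradedDualVVM F gr grM (g ∘ₗ TensorProduct.map (gradedProj hV p₁)
      (TensorProduct.map (gradedProj hV p₂) (gradedProj hM r))) := by
  refine ⟨{p₁ + p₂ + r}, fun q hq u hu => ?_⟩
  rw [LinearMap.comp_apply, map_gradedProj_eq_zero_of_mem_grVVM hV hM (by simpa using hq) hu,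
    map_zero]

lemma exists_map_gradedProj_comp_eq_zero (hV : DirectSum.IsInternal gr)
    (hM : DirectSum.IsInternal grM) (hbdd : ∃ N : ℚ, ∀ q : ℚ, q < N → grM q = ⊥)
    {ΔM : ℤ → M →ₗ[F] V ⊗[F] M}
    (hdeg : ∀ (j : ℚ) (k : ℤ), ∀ w ∈ grM j, ΔM k w ∈ grVM F gr grM (j + k + 1))
    (p : ℤ) (r : ℚ) :
    ∃ K : ℤ, ∀ n ≥ K, TensorProduct.map (gradedProj hV p) (gradedProj hM r) ∘ₗ ΔM n = 0 := by
  obtain ⟨N, hN⟩ := hbdd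
  obtain ⟨K, hK⟩ := exists_int_gt ((p : ℚ) + r - N - 1)
  refine ⟨K, fun n hn => linearMap_eq_zero_of_graded hM fun j w hw => ?_⟩
  have hn' : (K : ℚ) ≤ n := by exact_mod_cast hn
  by_cases hj : j < N
  · rw [hN j hj, Submodule.mem_bot] at hw
    rw [hw, map_zero]
  · exact map_gradedProj_eq_zero_of_mem_grVM hV hM
      (fun h => hj (by linarith)) (hdeg j n w hw)

/-- The covacuum of a graded vertex coalgebra is supported in weight `0`. -/
lemma covacuum_comp_gradedProj_zero {ΔV : ℤ → V →ₗ[F] V ⊗[F] V} {c : V →ₗ[F] F}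
    (hVC : IsVertexCoalgSansJacobi F ΔV c) (hV : DirectSum.IsInternal gr)
    (hdeg : ∀ r k : ℤ, ∀ v ∈ gr r, ΔV k v ∈ grT2 F gr (r + k + 1)) :
    c ∘ₗ gradedProj hV 0 = c := by
  obtain ⟨hcounit, -, hcocreate, -, -⟩ := hVC
  rw [← sub_eq_zero]
  refine linearMap_eq_zero_of_graded hV fun p v hv => ?_
  by_cases hp : p = 0
  · subst hp
    simp [gradedProj_of_mem hV hv]
  have key : ∀ u ∈ grT2 F gr p,
      cLeft F (c ∘ₗ gradedProj hV p) u = gradedProj hV 0 (cLeft F c u) := by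
    intro u hu
    rw [← sub_eq_zero]
    suffices grT2 F gr p ≤ LinearMap.ker (cLeft F (c ∘ₗ gradedProj hV p) -
      gradedProj hV 0 ∘ₗ (cLeft F c : V ⊗[F] V →ₗ[F] V)) from this hu
    refine iSup_le fun q => ?_
    rw [LinearMap.range_le_ker_iff]
    ext x y
    by_cases hq : q = p
    · subst hq
      have hy : (y : V) ∈ gr 0 := by simpa using y.2
      simp [cLeft, gradedProj_of_mem hV x.2, gradedProj_of_mem hV hy]
    · simp [cLeft, gradedProj_of_mem_ne hV hq x.2,
        gradedProj_of_mem_ne hV (sub_ne_zero.mpr (Ne.symm hq)) y.2]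
  have hΔ : ΔV (-1) v ∈ grT2 F gr p := by simpa using hdeg p (-1) v hv
  have h0 : cLeft F (c ∘ₗ gradedProj hV p) (ΔV (-1) v) = 0 := by
    rw [key _ hΔ, hcounit, gradedProj_of_mem_ne hV hp hv]
  have hswap : ∀ u : V ⊗[F] V, c (gradedProj hV p (cRight F c u)) =
      c (cLeft F (c ∘ₗ gradedProj hV p) u) := by
    intro u
    induction u using TensorProduct.induction_on with
    | zero => simp
    | tmul x y => simp [cLeft, cRight, mul_comm]
    | add x y hx hy => simp only [map_add, hx, hy]
  have hc : c v = 0 := by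
    have := hswap (ΔV (-1) v)
    rwa [hcocreate, gradedProj_of_mem hV hv, h0, map_zero] at this
  simp [gradedProj_of_mem_ne hV hp hv, hc]

end Gradings

section Comodule

variable {F}

/-- The defect of the comodule Jacobi identity at `w`. -/
def comoduleDefect (ΔV : ℤ → V →ₗ[F] V ⊗[F] V) (ΔM : ℤ → M →ₗ[F] V ⊗[F] M) (w : M) :
    ℤ → ℤ → ℤ → V ⊗[F] (V ⊗[F] M) :=
  jacobiDefect F (fun m n => comp12 F ΔM m n w) (fun m n => Tfirst F (comp12 F ΔM m n w))
    (fun m n => compR F ΔV ΔM m n w)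

lemma truncFst_comp12 {ΔM : ℤ → M →ₗ[F] V ⊗[F] M} {w : M}
    (hw : ∃ N : ℤ, ∀ k < N, ΔM k w = 0) : TruncFst fun m n => comp12 F ΔM m n w := by
  obtain ⟨N, hN⟩ := hw
  exact ⟨N, fun m hm n => by simp [comp12, hN m hm]⟩

lemma truncSnd_compR (ΔV : ℤ → V →ₗ[F] V ⊗[F] V) {ΔM : ℤ → M →ₗ[F] V ⊗[F] M} {w : M}
    (hw : ∃ N : ℤ, ∀ k < N, ΔM k w = 0) : TruncSnd fun m n => compR F ΔV ΔM m n w := by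
  obtain ⟨N, hN⟩ := hw
  exact ⟨N, fun n hn m => by simp [compR, hN n hn]⟩

lemma comoduleDefect_rec (ΔV : ℤ → V →ₗ[F] V ⊗[F] V) {ΔM : ℤ → M →ₗ[F] V ⊗[F] M} {w : M}
    (hw : ∃ N : ℤ, ∀ k < N, ΔM k w = 0) : DeltaRec (comoduleDefect ΔV ΔM w) :=
  jacobiDefect_rec (truncFst_comp12 hw) ((truncFst_comp12 hw).map (Tfirst F))
    (truncSnd_compR ΔV hw)

lemma map_comoduleDefect {W : Type} [AddCommGroup W] [Module F W]
    (L : V ⊗[F] (V ⊗[F] M) →ₗ[F] W) (ΔV : ℤ → V →ₗ[F] V ⊗[F] V)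
    {ΔM : ℤ → M →ₗ[F] V ⊗[F] M} {w : M} (hw : ∃ N : ℤ, ∀ k < N, ΔM k w = 0) (a b c : ℤ) :
    L (comoduleDefect ΔV ΔM w a b c) =
      jacobiDefect F (fun m n => L (comp12 F ΔM m n w))
        (fun m n => L (Tfirst F (comp12 F ΔM m n w)))
        (fun m n => L (compR F ΔV ΔM m n w)) a b c :=
  map_jacobiDefect L (truncFst_comp12 hw) ((truncFst_comp12 hw).map (Tfirst F))
    (truncSnd_compR ΔV hw) a b c

lemma jacobiId_iff {ΔV : ℤ → V →ₗ[F] V ⊗[F] V} {ΔM : ℤ → M →ₗ[F] V ⊗[F] M}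
    (htrunc : ∀ w : M, ∃ N : ℤ, ∀ k < N, ΔM k w = 0) :
    JacobiId F ΔV ΔM ↔ ∀ (w : M) (a b c : ℤ), comoduleDefect ΔV ΔM w a b c = 0 := by
  have key : ∀ (a b c : ℤ) (w : M),
      (∑ᶠ i : ℕ, ((-1 : F) ^ i * gchoose F a i) •
        (comp12 F ΔM (a + b - i) (c + i) w -
          (-1 : F) ^ a • Tfirst F (comp12 F ΔM (a + c - i) (b + i) w))) =
      deltaDiff F (fun m n => comp12 F ΔM m n w) a b c -
        (-1 : F) ^ a • deltaDiff F (fun m n => Tfirst F (comp12 F ΔM m n w)) a c b := by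
    intro a b c w
    have h1 := (truncFst_comp12 (htrunc w)).eventually (a + b) fun i => c + i
    have h2 := ((truncFst_comp12 (htrunc w)).map (Tfirst F)).eventually (a + c) fun i => b + i
    have h3 : ∀ᶠ i : ℕ in Filter.atTop, gchoose F a i • (-1 : F) ^ i •
        Tfirst F (comp12 F ΔM (a + c - i) (b + i) w) = 0 := by
      filter_upwards [h2] with i hi
      rw [hi, smul_zero, smul_zero]
    rw [deltaDiff, deltaDiff, smul_finsum_of_eventually _ h3, ← finsum_sub_of_eventually]
    · refine finsum_congr fun i => ?_
      module
    · filter_upwards [h1] with i hi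
      rw [hi, smul_zero, smul_zero]
    · filter_upwards [h3] with i hi
      rw [hi, smul_zero]
  simp only [JacobiId, key, comoduleDefect, jacobiDefect, sub_eq_zero]
  exact ⟨fun h w a b c => h a b c w, fun h a b c w => h w a b c⟩

lemma Tfirst_Tfirst (u : V ⊗[F] (V ⊗[F] M)) : Tfirst F (Tfirst F u) = u := by
  suffices Tfirst F ∘ₗ Tfirst F = (LinearMap.id : V ⊗[F] (V ⊗[F] M) →ₗ[F] _) from
    LinearMap.congr_fun this u
  ext x y z
  simp [Tfirst]

lemma map_map_Tfirst (P Q : V →ₗ[F] V) (R : M →ₗ[F] M) (u : V ⊗[F] (V ⊗[F] M)) :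
    TensorProduct.map P (TensorProduct.map Q R) (Tfirst F u) =
      Tfirst F (TensorProduct.map Q (TensorProduct.map P R) u) := by
  suffices TensorProduct.map P (TensorProduct.map Q R) ∘ₗ Tfirst F =
    Tfirst F ∘ₗ TensorProduct.map Q (TensorProduct.map P R) from LinearMap.congr_fun this u
  ext x y z
  simp [Tfirst]

/-- Skew-symmetry of a vertex coalgebra: `T Y(x) = Y(-x) e^{xD}`, where the divided power `D^(j)`
is `(Id ⊗ c) Δ_{-1-j}`. -/
lemma comm_coproduct {ΔV : ℤ → V →ₗ[F] V ⊗[F] V} {c : V →ₗ[F] F} (hVC : IsVertexCoalg F ΔV c)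
    (a : ℤ) (v : V) :
    (-1 : F) ^ a • TensorProduct.comm F V V (ΔV a v) =
      -∑ᶠ j : ℕ, (-1 : F) ^ j • ΔV (a + j) (cRight F c (ΔV (-1 - j) v)) := by
  obtain ⟨⟨-, -, hcre, hcre', htrunc⟩, hJ⟩ := hVC
  have h := (jacobiId_iff htrunc).mp hJ v a (-1) 0
  let R : V ⊗[F] (V ⊗[F] V) →ₗ[F] V ⊗[F] V := TensorProduct.map LinearMap.id (cRight F c)
  have hA : ∀ m n, R (comp12 F ΔV m n v) =
      TensorProduct.map LinearMap.id (cRight F c ∘ₗ ΔV n) (ΔV m v) := fun m n => by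
    simp only [R, comp12, LinearMap.comp_apply]
    rw [← LinearMap.comp_apply, ← TensorProduct.map_comp, LinearMap.id_comp]
  have hRT : ∀ u : V ⊗[F] (V ⊗[F] V), R (Tfirst F u) = TensorProduct.comm F V V (R u) := by
    intro u
    suffices R ∘ₗ Tfirst F = (TensorProduct.comm F V V).toLinearMap ∘ₗ R from
      LinearMap.congr_fun this u
    ext x y z
    simp [R, Tfirst, cRight]
  have hC : ∀ m n, R (compR F ΔV ΔV m n v) = ΔV m (cRight F c (ΔV n v)) := by
    intro m n
    suffices R ∘ₗ (TensorProduct.assoc F V V V).toLinearMap ∘ₗ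
        TensorProduct.map (ΔV m) LinearMap.id = ΔV m ∘ₗ (cRight F c : V ⊗[F] V →ₗ[F] V) from
      LinearMap.congr_fun this (ΔV n v)
    refine TensorProduct.ext' fun x y => ?_
    simp only [LinearMap.comp_apply, TensorProduct.map_tmul, LinearMap.id_apply]
    have aux : ∀ u : V ⊗[F] V, R (TensorProduct.assoc F V V V (u ⊗ₜ y)) = c y • u := by
      intro u
      induction u using TensorProduct.induction_on with
      | zero => simp
      | tmul s t => simp [R, cRight]
      | add s t hs ht => simp only [TensorProduct.add_tmul, map_add, hs, ht, smul_add]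
    simpa [cRight] using aux (ΔV m x)
  have hA0 : ∀ m n, 0 ≤ n → R (comp12 F ΔV m n v) = 0 := fun m n hn => by
    rw [hA, show cRight F c ∘ₗ ΔV n = 0 from LinearMap.ext (hcre' n hn),
      TensorProduct.map_zero_right, LinearMap.zero_apply]
  have hA1 : ∀ m, R (comp12 F ΔV m (-1) v) = ΔV m v := fun m => by
    rw [hA, show cRight F c ∘ₗ ΔV (-1) = LinearMap.id from LinearMap.ext hcre,
      TensorProduct.map_id, LinearMap.id_apply]
  have h' := congrArg R h
  rw [map_comoduleDefect R ΔV (htrunc v), map_zero, jacobiDefect] at h'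
  have e1 : deltaDiff F (fun m n => R (comp12 F ΔV m n v)) a (-1) 0 = 0 := by
    refine finsum_eq_zero_of_forall_eq_zero fun i => ?_
    beta_reduce
    rw [hA0 _ _ (by omega), smul_zero, smul_zero]
  have e2 : deltaDiff F (fun m n => R (Tfirst F (comp12 F ΔV m n v))) a 0 (-1) =
      TensorProduct.comm F V V (ΔV a v) := by
    rw [deltaDiff, finsum_eq_sum_range (N := 1)]
    · simp [gchoose_zero_right, hRT, hA1]
    · intro i hi
      rw [hRT, hA0 _ _ (by omega), map_zero, smul_zero, smul_zero]
  have e3 : deltaIter F (fun m n => R (compR F ΔV ΔV m n v)) a (-1) 0 =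
      ∑ᶠ j : ℕ, (-1 : F) ^ j • ΔV (a + j) (cRight F c (ΔV (-1 - j) v)) := by
    rw [deltaIter]
    refine finsum_congr fun i => ?_
    rw [hC, gchoose_neg_one, add_zero]
  rw [e1, e2, e3] at h'
  rw [eq_neg_iff_add_eq_zero, ← neg_eq_zero, ← h']
  abel

/-- Contraction of the middle tensor factor with `c`. -/
def cMiddle (c : V →ₗ[F] F) : V ⊗[F] (V ⊗[F] M) →ₗ[F] V ⊗[F] M :=
  TensorProduct.map LinearMap.id (cLeft F c)

lemma map_cMiddle {c : V →ₗ[F] F} {Q : V →ₗ[F] V} (hQ : c ∘ₗ Q = c) (P : V →ₗ[F] V)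
    (R : M →ₗ[F] M) (u : V ⊗[F] (V ⊗[F] M)) :
    TensorProduct.map P R (cMiddle c u) =
      cMiddle c (TensorProduct.map P (TensorProduct.map Q R) u) := by
  suffices TensorProduct.map P R ∘ₗ cMiddle c =
    cMiddle c ∘ₗ TensorProduct.map P (TensorProduct.map Q R) from LinearMap.congr_fun this u
  ext x y z
  have : c (Q y) = c y := LinearMap.congr_fun hQ y
  simp [cMiddle, cLeft, this]

lemma cMiddle_comp12 {c : V →ₗ[F] F} {ΔM : ℤ → M →ₗ[F] V ⊗[F] M}
    (hcounit : ∀ w : M, cLeft F c (ΔM (-1) w) = w)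
    (hcounit' : ∀ k : ℤ, k ≠ -1 → ∀ w : M, cLeft F c (ΔM k w) = 0) (m n : ℤ) (w : M) :
    cMiddle c (comp12 F ΔM m n w) = if n = -1 then ΔM m w else 0 := by
  rw [cMiddle, comp12, LinearMap.comp_apply, ← LinearMap.comp_apply, ← TensorProduct.map_comp,
    LinearMap.id_comp]
  split_ifs with hn
  · subst hn
    rw [show cLeft F c ∘ₗ ΔM (-1) = LinearMap.id from LinearMap.ext hcounit,
      TensorProduct.map_id, LinearMap.id_apply]
  · rw [show cLeft F c ∘ₗ ΔM n = 0 from LinearMap.ext (hcounit' n hn),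
      TensorProduct.map_zero_right, LinearMap.zero_apply]

lemma cMiddle_Tfirst_comp12 {c : V →ₗ[F] F} {ΔM : ℤ → M →ₗ[F] V ⊗[F] M}
    (hcounit : ∀ w : M, cLeft F c (ΔM (-1) w) = w)
    (hcounit' : ∀ k : ℤ, k ≠ -1 → ∀ w : M, cLeft F c (ΔM k w) = 0) (m n : ℤ) (w : M) :
    cMiddle c (Tfirst F (comp12 F ΔM m n w)) = if m = -1 then ΔM n w else 0 := by
  have h1 : ∀ u : V ⊗[F] M, cMiddle c (Tfirst F (TensorProduct.map LinearMap.id (ΔM n) u)) =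
      ΔM n (cLeft F c u) := by
    intro u
    suffices cMiddle c ∘ₗ Tfirst F ∘ₗ TensorProduct.map LinearMap.id (ΔM n) =
      ΔM n ∘ₗ cLeft F c from LinearMap.congr_fun this u
    refine TensorProduct.ext' fun x y => ?_
    have aux : ∀ u : V ⊗[F] M, cMiddle c (Tfirst F (x ⊗ₜ u)) = c x • u := by
      intro u
      induction u using TensorProduct.induction_on with
      | zero => simp
      | tmul s t => simp [cMiddle, cLeft, Tfirst]
      | add s t hs ht => simp only [TensorProduct.tmul_add, map_add, hs, ht, smul_add]
    simpa [cLeft] using aux (ΔM n y)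
  rw [comp12, LinearMap.comp_apply, h1]
  split_ifs with hm
  · rw [hm, hcounit]
  · rw [hcounit' m hm, map_zero]

lemma cMiddle_compR (c : V →ₗ[F] F) (ΔV : ℤ → V →ₗ[F] V ⊗[F] V)
    (ΔM : ℤ → M →ₗ[F] V ⊗[F] M) (m n : ℤ) (w : M) :
    cMiddle c (compR F ΔV ΔM m n w) =
      TensorProduct.map (cRight F c ∘ₗ ΔV m) LinearMap.id (ΔM n w) := by
  suffices cMiddle c ∘ₗ (TensorProduct.assoc F V V M).toLinearMap ∘ₗ
      TensorProduct.map (ΔV m) LinearMap.id =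
      TensorProduct.map (cRight F c ∘ₗ ΔV m) LinearMap.id from
    LinearMap.congr_fun this (ΔM n w)
  refine TensorProduct.ext' fun x y => ?_
  have aux : ∀ u : V ⊗[F] V, cMiddle c (TensorProduct.assoc F V V M (u ⊗ₜ y)) =
      cRight F c u ⊗ₜ y := by
    intro u
    induction u using TensorProduct.induction_on with
    | zero => simp
    | tmul s t => simp [cMiddle, cLeft, cRight, TensorProduct.smul_tmul]
    | add s t hs ht => simp only [TensorProduct.add_tmul, map_add, hs, ht]
  simpa using aux (ΔV m x)

end Comodule

section WeakCoassociativity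

variable {F} {gr : ℤ → Submodule F V} {grM : ℚ → Submodule F M} {c : V →ₗ[F] F}
  {ΔV : ℤ → V →ₗ[F] V ⊗[F] V} {ΔM : ℤ → M →ₗ[F] V ⊗[F] M}

/-- Under weak coassociativity, each graded component of the Jacobi defect vanishes on some plane
`b = K`. -/
lemma exists_defect_plane_eq_zero (hV : DirectSum.IsInternal gr)
    (hmod : IsComoduleSansJacobi F c ΔM gr grM) (hM : DirectSum.IsInternal grM)
    (hwassoc : ∀ (f : V ⊗[F] (V ⊗[F] M) →ₗ[F] F), GradedDualVVM F gr grM f →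
      ∃ k : ℕ, 0 < k ∧ WeakCoassoc F ΔV ΔM f k)
    (p q : ℤ) (r : ℚ) (g : V ⊗[F] (V ⊗[F] M) →ₗ[F] F) (w : M) :
    ∃ K : ℤ, ∀ a d, g (TensorProduct.map (gradedProj hV p)
      (TensorProduct.map (gradedProj hV q) (gradedProj hM r))
        (comoduleDefect ΔV ΔM w a K d)) = 0 := by
  obtain ⟨-, -, htrunc, -, hbdd, hdeg⟩ := hmod
  let P := TensorProduct.map (gradedProj hV p)
    (TensorProduct.map (gradedProj hV q) (gradedProj hM r))
  obtain ⟨k, -, hk⟩ := hwassoc (g ∘ₗ P) (gradedDualVVM_comp_gradedProj hV hM p q r g)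
  obtain ⟨K, hK⟩ := exists_map_gradedProj_comp_eq_zero hV hM hbdd hdeg p r
  have hA := truncFst_comp12 (htrunc w)
  have hC := truncSnd_compR ΔV (htrunc w)
  let X : ℤ → ℤ → ℤ → F := fun a b d =>
    (g ∘ₗ P) (deltaIter F (fun m n => compR F ΔV ΔM m n w) a b d) -
      (g ∘ₗ P) (deltaDiff F (fun m n => comp12 F ΔM m n w) a b d)
  have hX : DeltaRec X := ((deltaIter_rec hC).map _).sub ((deltaDiff_rec hA).map _)
  have hX0 : ∀ a d, X a 0 d = (g ∘ₗ P) (compR F ΔV ΔM a d w) -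
      ∑ᶠ i : ℕ, ((-1 : F) ^ i * gchoose F a i) *
        (g ∘ₗ P) (comp12 F ΔM (a - i) (d + i) w) := by
    intro a d
    simp only [X, map_deltaDiff (g ∘ₗ P) hA]
    congr 1
    · rw [deltaIter, finsum_gchoose_zero]
      simp
    · refine finsum_congr fun i => ?_
      rw [add_zero, smul_eq_mul, smul_eq_mul]
      ring
  have hXk : ∀ a d, X a k d = 0 := by
    intro a d
    have h := hX.sum_choose (F := F) k 0 a d
    rw [zero_add] at h
    rw [h, ← hk w a d]
    refine Finset.sum_congr rfl fun j _ => ?_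
    rw [hX0, smul_eq_mul]
  have hB : ∀ m n, K ≤ n → P (Tfirst F (comp12 F ΔM m n w)) = 0 := by
    intro m n hn
    rw [map_map_Tfirst, comp12, LinearMap.comp_apply, ← LinearMap.comp_apply (TensorProduct.map _ _),
      ← TensorProduct.map_comp, hK n hn, TensorProduct.map_zero_right, LinearMap.zero_apply,
      map_zero]
  refine ⟨max k K, fun a d => ?_⟩
  have h1 := hX.eq_zero_of_le hXk (le_max_left (k : ℤ) K) a d
  have h2 : P (deltaDiff F (fun m n => Tfirst F (comp12 F ΔM m n w)) a d (max k K)) = 0 := by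
    rw [map_deltaDiff P (hA.map (Tfirst F))]
    refine finsum_eq_zero_of_forall_eq_zero fun i => ?_
    beta_reduce
    rw [hB _ _ (by omega), smul_zero, smul_zero]
  change (g ∘ₗ P) (comoduleDefect ΔV ΔM w a (max k K) d) = 0
  rw [comoduleDefect, jacobiDefect, map_sub, map_sub, map_smul, LinearMap.comp_apply g P
    (deltaDiff F (fun m n => Tfirst F (comp12 F ΔM m n w)) a d (max k K)), h2, map_zero,
    smul_zero, sub_zero, ← neg_eq_zero, neg_sub]
  exact h1

/-- The Jacobi identity holds after contracting the middle factor with the covacuum. -/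
lemma cMiddle_comoduleDefect (hVC : IsVertexCoalgSansJacobi F ΔV c) (hgr : IsGradedVC F ΔV gr)
    (hmod : IsComoduleSansJacobi F c ΔM gr grM)
    (hwassoc : ∀ (f : V ⊗[F] (V ⊗[F] M) →ₗ[F] F), GradedDualVVM F gr grM f →
      ∃ k : ℕ, 0 < k ∧ WeakCoassoc F ΔV ΔM f k) (w : M) (a b d : ℤ) :
    cMiddle c (comoduleDefect ΔV ΔM w a b d) = 0 := by
  obtain ⟨hV, -, hdegV⟩ := hgr
  obtain ⟨hcounit, hcounit', htrunc, hM, -, -⟩ := id hmod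
  have hc := covacuum_comp_gradedProj_zero hVC hV hdegV
  obtain ⟨-, -, -, hcre', -⟩ := hVC
  have hplane : ∀ b d, cMiddle c (comoduleDefect ΔV ΔM w 0 b d) = 0 := by
    intro b d
    rw [map_comoduleDefect _ _ (htrunc w), jacobiDefect, deltaDiff, deltaDiff,
      finsum_gchoose_zero, finsum_gchoose_zero]
    have h0 : deltaIter F (fun m n => cMiddle c (compR F ΔV ΔM m n w)) 0 b d = 0 := by
      refine finsum_eq_zero_of_forall_eq_zero fun i => ?_
      beta_reduce
      rw [cMiddle_compR, show cRight F c ∘ₗ ΔV (0 + i) = 0 from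
        LinearMap.ext (hcre' _ (by omega)), TensorProduct.map_zero_left, LinearMap.zero_apply,
        smul_zero]
    simp [h0, cMiddle_comp12 hcounit hcounit', cMiddle_Tfirst_comp12 hcounit hcounit']
  refine (resolves_gradedProj hV).tensor_eq_zero (resolves_gradedProj hM) fun p r => ?_
  rw [← Module.forall_dual_apply_eq_zero_iff F]
  intro g
  obtain ⟨K, hK⟩ := exists_defect_plane_eq_zero hV hmod hM hwassoc p 0 r (g ∘ₗ cMiddle c) w
  let X : ℤ → ℤ → ℤ → F := fun a b d => g (TensorProduct.map (gradedProj hV p)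
    (gradedProj hM r) (cMiddle c (comoduleDefect ΔV ΔM w a b d)))
  have hX : DeltaRec X :=
    (((comoduleDefect_rec ΔV (htrunc w)).map (cMiddle c)).map (TensorProduct.map _ _)).map g
  refine hX.eq_zero (k := K) (fun a d => ?_) (fun a b d => ⟨-a, ?_⟩) a b d
  · simp only [X]
    rw [map_cMiddle hc]
    exact hK a d
  · simp only [X]
    rw [add_neg_cancel, hplane, map_zero, map_zero]

/-- The translation property `Y(x₂) = (e^{-x₀D} ⊗ Id) Y(x₂ + x₀)` of a comodule. -/
lemma sum_gchoose_smul_translate (hVC : IsVertexCoalgSansJacobi F ΔV c)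
    (hgr : IsGradedVC F ΔV gr) (hmod : IsComoduleSansJacobi F c ΔM gr grM)
    (hwassoc : ∀ (f : V ⊗[F] (V ⊗[F] M) →ₗ[F] F), GradedDualVVM F gr grM f →
      ∃ k : ℕ, 0 < k ∧ WeakCoassoc F ΔV ΔM f k) (w : M) (l : ℕ) (b : ℤ) :
    ∑ i ∈ Finset.range (l + 1), gchoose F b i •
      TensorProduct.map (cRight F c ∘ₗ ΔV (-1 - ((l - i : ℕ) : ℤ))) LinearMap.id (ΔM (b - i) w) =
      if l = 0 then ΔM b w else 0 := by
  have h := cMiddle_comoduleDefect hVC hgr hmod hwassoc w (-1 - l) b 0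
  obtain ⟨hcounit, hcounit', htrunc, -, -, -⟩ := hmod
  obtain ⟨-, -, -, hcre', -⟩ := hVC
  rw [map_comoduleDefect _ _ (htrunc w), jacobiDefect] at h
  have e1 : deltaDiff F (fun m n => cMiddle c (comp12 F ΔM m n w)) (-1 - l) b 0 = 0 := by
    refine finsum_eq_zero_of_forall_eq_zero fun i => ?_
    beta_reduce
    rw [cMiddle_comp12 hcounit hcounit', if_neg (by omega), smul_zero, smul_zero]
  have e2 : deltaDiff F (fun m n => cMiddle c (Tfirst F (comp12 F ΔM m n w))) (-1 - l) 0 b =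
      if l = 0 then ΔM b w else 0 := by
    rw [deltaDiff, finsum_eq_sum_range (N := 1)]
    · rw [Finset.sum_range_one, gchoose_zero_right, cMiddle_Tfirst_comp12 hcounit hcounit']
      by_cases hl : l = 0
      · simp [hl]
      · rw [if_neg (by omega), if_neg hl, smul_zero, smul_zero]
    · intro i hi
      rw [cMiddle_Tfirst_comp12 hcounit hcounit', if_neg (by omega), smul_zero, smul_zero]
  have e3 : deltaIter F (fun m n => cMiddle c (compR F ΔV ΔM m n w)) (-1 - l) b 0 =
      ∑ i ∈ Finset.range (l + 1), gchoose F b i • TensorProduct.map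
        (cRight F c ∘ₗ ΔV (-1 - ((l - i : ℕ) : ℤ))) LinearMap.id (ΔM (b - i) w) := by
    rw [deltaIter, finsum_eq_sum_range (N := l + 1)]
    · refine Finset.sum_congr rfl fun i hi => ?_
      rw [Finset.mem_range] at hi
      rw [cMiddle_compR, add_zero, show -1 - (l : ℤ) + i = -1 - ((l - i : ℕ) : ℤ) by omega]
    · intro i hi
      rw [cMiddle_compR, show cRight F c ∘ₗ ΔV (-1 - l + i) = 0 from
        LinearMap.ext (hcre' _ (by omega)), TensorProduct.map_zero_left, LinearMap.zero_apply,
        smul_zero]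
  rw [e1, e2, e3, zero_sub, sub_eq_zero] at h
  rw [← h]
  split_ifs with hl
  · subst hl
    simp
  · simp

lemma eventually_map_cRight_eq_zero (htrunc : ∀ v : V, ∃ N : ℤ, ∀ k < N, ΔV k v = 0)
    (u : V ⊗[F] M) :
    ∀ᶠ j : ℕ in Filter.atTop,
      TensorProduct.map (cRight F c ∘ₗ ΔV (-1 - j)) LinearMap.id u = 0 := by
  induction u using TensorProduct.induction_on with
  | zero => simp
  | tmul x y =>
    obtain ⟨N, hN⟩ := htrunc x
    filter_upwards [Filter.eventually_gt_atTop (-N).toNat] with j hj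
    rw [TensorProduct.map_tmul, LinearMap.comp_apply, hN _ (by omega), map_zero,
      TensorProduct.zero_tmul]
  | add x y hx hy =>
    filter_upwards [hx, hy] with j hx hy
    rw [map_add, hx, hy, add_zero]

/-- Skew-symmetry of the vertex coalgebra inside the first factor of `V ⊗ M`. -/
lemma Tfirst_map_coproduct (hVC : IsVertexCoalg F ΔV c) (m : ℤ) (u : V ⊗[F] M) :
    (-1 : F) ^ m • Tfirst F (TensorProduct.assoc F V V M
      (TensorProduct.map (ΔV m) LinearMap.id u)) =
    -∑ᶠ j : ℕ, (-1 : F) ^ j • TensorProduct.assoc F V V M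
      (TensorProduct.map (ΔV (m + j)) LinearMap.id
        (TensorProduct.map (cRight F c ∘ₗ ΔV (-1 - j)) LinearMap.id u)) := by
  have htrunc := hVC.1.2.2.2.2
  induction u using TensorProduct.induction_on with
  | zero => simp
  | tmul x y =>
    have hx : ∀ᶠ j : ℕ in Filter.atTop,
        (-1 : F) ^ j • ΔV (m + j) (cRight F c (ΔV (-1 - j) x)) = 0 := by
      obtain ⟨N, hN⟩ := htrunc x
      filter_upwards [Filter.eventually_gt_atTop (-N).toNat] with j hj
      rw [hN _ (by omega), map_zero, map_zero, smul_zero]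
    let L : V ⊗[F] V →ₗ[F] V ⊗[F] (V ⊗[F] M) :=
      (TensorProduct.assoc F V V M).toLinearMap ∘ₗ (TensorProduct.mk F (V ⊗[F] V) M).flip y
    have h := congrArg L (comm_coproduct hVC m x)
    rw [map_neg, map_finsum_of_eventually L hx] at h
    simpa [L, Tfirst] using h
  | add x y hx hy =>
    have hev : ∀ z : V ⊗[F] M, ∀ᶠ j : ℕ in Filter.atTop,
        (-1 : F) ^ j • TensorProduct.assoc F V V M (TensorProduct.map (ΔV (m + j)) LinearMap.id
          (TensorProduct.map (cRight F c ∘ₗ ΔV (-1 - j)) LinearMap.id z)) = 0 := by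
      intro z
      filter_upwards [eventually_map_cRight_eq_zero (c := c) htrunc z] with j hj
      rw [hj, map_zero, map_zero, smul_zero]
    simp only [map_add, smul_add, hx, hy]
    rw [finsum_add_distrib (finite_support_of_eventually (hev x))
      (finite_support_of_eventually (hev y)), neg_add]

lemma deltaIter_Tfirst_compR_zero (hVC : IsVertexCoalg F ΔV c) (hgr : IsGradedVC F ΔV gr)
    (hmod : IsComoduleSansJacobi F c ΔM gr grM)
    (hwassoc : ∀ (f : V ⊗[F] (V ⊗[F] M) →ₗ[F] F), GradedDualVVM F gr grM f →
      ∃ k : ℕ, 0 < k ∧ WeakCoassoc F ΔV ΔM f k) (w : M) (a b : ℤ) :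
    deltaIter F (fun m n => Tfirst F (compR F ΔV ΔM m n w)) a b 0 =
      -(-1 : F) ^ a • compR F ΔV ΔM a b w := by
  have htranslate := sum_gchoose_smul_translate hVC.1 hgr hmod hwassoc w
  obtain ⟨-, -, htrunc, -, -, -⟩ := hmod
  let Γ : ℤ → V ⊗[F] M →ₗ[F] V ⊗[F] (V ⊗[F] M) := fun m =>
    (TensorProduct.assoc F V V M).toLinearMap ∘ₗ TensorProduct.map (ΔV m) LinearMap.id
  let E : ℕ → ℕ → V ⊗[F] M := fun j i =>
    TensorProduct.map (cRight F c ∘ₗ ΔV (-1 - j)) LinearMap.id (ΔM (b - i) w)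
  obtain ⟨N, hN0, hN, hE⟩ : ∃ N : ℕ, 0 < N ∧ (∀ i ≥ N, ΔM (b - i) w = 0) ∧
      ∀ i j, N ≤ j → E j i = 0 := by
    obtain ⟨N₁, hN₁⟩ := htrunc w
    have hN₁' : ∀ i : ℕ, (b - N₁).toNat + 1 ≤ i → ΔM (b - i) w = 0 := fun i hi =>
      hN₁ _ (by omega)
    have hev : ∀ᶠ j in Filter.atTop, ∀ i ∈ Finset.range ((b - N₁).toNat + 1), E j i = 0 :=
      (Filter.eventually_all_finset _).mpr fun i _ =>
        eventually_map_cRight_eq_zero hVC.1.2.2.2.2 _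
    obtain ⟨N₂, hN₂⟩ := Filter.eventually_atTop.mp hev
    refine ⟨max ((b - N₁).toNat + 1) N₂, by omega, fun i hi => hN₁' i (by omega),
      fun i j hj => ?_⟩
    by_cases hi : i < (b - N₁).toNat + 1
    · exact hN₂ j (by omega) i (Finset.mem_range.mpr hi)
    · simp only [E, hN₁' i (by omega), map_zero]
  have hE' : ∀ i j, N ≤ i → E j i = 0 := fun i j hi => by simp only [E, hN i hi, map_zero]
  let H : ℕ → ℕ → V ⊗[F] (V ⊗[F] M) := fun i j =>
    gchoose F b i • (-1 : F) ^ (i + j) • Γ (a + i + j) (E j i)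
  have hterm : ∀ i : ℕ, gchoose F b i • Tfirst F (compR F ΔV ΔM (a + i) (b + 0 - i) w) =
      -(-1 : F) ^ a • ∑ j ∈ Finset.range N, H i j := by
    intro i
    have h := Tfirst_map_coproduct hVC (a + i) (ΔM (b - i) w)
    rw [finsum_eq_sum_range (N := N) fun j hj => by
      change (-1 : F) ^ j • Γ (a + i + j) (E j i) = 0
      rw [hE i j hj, map_zero, smul_zero]] at h
    have hsq : (-1 : F) ^ (a + i) * (-1 : F) ^ (a + i) = 1 := by
      rw [← mul_zpow]
      simp
    have h' := congrArg (fun z => (-1 : F) ^ (a + i) • z) h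
    simp only [smul_smul, hsq, one_smul] at h'
    rw [add_zero]
    change gchoose F b i • Tfirst F (TensorProduct.assoc F V V M
      (TensorProduct.map (ΔV (a + i)) LinearMap.id (ΔM (b - i) w))) = _
    rw [h', zpow_add₀ (neg_ne_zero.mpr one_ne_zero), zpow_natCast, smul_neg, smul_neg, neg_smul,
      Finset.smul_sum, Finset.smul_sum, Finset.smul_sum]
    congr 1
    refine Finset.sum_congr rfl fun j _ => ?_
    simp only [H, smul_smul]
    change _ • Γ (a + i + j) (E j i) = _
    congr 1
    ring
  have hflip : ∑ i ∈ Finset.range N, ∑ j ∈ Finset.range N, H i j = Γ a (ΔM b w) := by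
    have h1 := Finset.sum_range_diag_flip (2 * N) H
    have h2 : ∑ i ∈ Finset.range (2 * N), ∑ j ∈ Finset.range (2 * N - i), H i j =
        ∑ i ∈ Finset.range N, ∑ j ∈ Finset.range N, H i j := by
      rw [← Finset.sum_subset (Finset.range_mono (show N ≤ 2 * N by omega))]
      · refine Finset.sum_congr rfl fun i hi => ?_
        rw [Finset.mem_range] at hi
        rw [← Finset.sum_subset (Finset.range_mono (show N ≤ 2 * N - i by omega))]
        intro j _ hj
        simp only [H, hE i j (by simpa using hj), map_zero, smul_zero]
      · intro i _ hi
        refine Finset.sum_eq_zero fun j _ => ?_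
        simp only [H, hE' i j (by simpa using hi), map_zero, smul_zero]
    have h3 : ∀ l : ℕ, ∑ i ∈ Finset.range (l + 1), H i (l - i) =
        (-1 : F) ^ l • Γ (a + l) (if l = 0 then ΔM b w else 0) := by
      intro l
      rw [← htranslate l b, map_sum, Finset.smul_sum]
      refine Finset.sum_congr rfl fun i hi => ?_
      rw [Finset.mem_range] at hi
      simp only [H, map_smul]
      rw [show i + (l - i) = l by omega, show a + (i : ℤ) + ((l - i : ℕ) : ℤ) = a + l by omega,
        smul_comm]
    rw [← h2, ← h1, Finset.sum_congr rfl fun l _ => h3 l,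
      Finset.sum_eq_single_of_mem 0 (Finset.mem_range.mpr (by omega))]
    · simp
    · intro l _ hl
      rw [if_neg hl, map_zero, smul_zero]
  rw [deltaIter, finsum_eq_sum_range (N := N), Finset.sum_congr rfl fun i _ => hterm i,
    ← Finset.smul_sum, hflip]
  · rfl
  · intro i hi
    rw [compR, LinearMap.comp_apply, add_zero, LinearMap.comp_apply, hN i hi]
    simp

lemma deltaIter_Tfirst_compR (hVC : IsVertexCoalg F ΔV c) (hgr : IsGradedVC F ΔV gr)
    (hmod : IsComoduleSansJacobi F c ΔM gr grM)
    (hwassoc : ∀ (f : V ⊗[F] (V ⊗[F] M) →ₗ[F] F), GradedDualVVM F gr grM f →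
      ∃ k : ℕ, 0 < k ∧ WeakCoassoc F ΔV ΔM f k) (w : M) (a b d : ℤ) :
    deltaIter F (fun m n => Tfirst F (compR F ΔV ΔM m n w)) a b d =
      -(-1 : F) ^ a • deltaIter F (fun m n => compR F ΔV ΔM m n w) a d b := by
  have hC := truncSnd_compR ΔV (hmod.2.2.1 w)
  have hTC := hC.map (Tfirst F)
  let X : ℤ → ℤ → ℤ → V ⊗[F] (V ⊗[F] M) := fun a b d =>
    (-1 : F) ^ a • deltaIter F (fun m n => Tfirst F (compR F ΔV ΔM m n w)) a d b -
      -deltaIter F (fun m n => compR F ΔV ΔM m n w) a b d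
  have hX : DeltaRec X := by
    refine (deltaIter_rec hTC).swap.sub fun a b d => ?_
    simp only [deltaIter_rec hC a b d]
    abel
  have hsq : ∀ a : ℤ, (-1 : F) ^ a * (-1 : F) ^ a = 1 := fun a => by
    rw [← mul_zpow]
    simp
  have h0 : ∀ a d, X a 0 d = 0 := by
    intro a d
    simp only [X]
    rw [deltaIter_Tfirst_compR_zero hVC hgr hmod hwassoc, smul_smul, mul_neg, hsq, deltaIter,
      finsum_gchoose_zero]
    simp
  have hline : ∀ a b d, ∃ t, X (a + t) b (d - t) = 0 := by
    intro a b d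
    obtain ⟨N, hN⟩ := hC
    refine ⟨b + d - N + 1, ?_⟩
    have h1 : deltaIter F (fun m n => compR F ΔV ΔM m n w) (a + (b + d - N + 1)) b
        (d - (b + d - N + 1)) = 0 :=
      finsum_eq_zero_of_forall_eq_zero fun i => by rw [hN _ (by omega), smul_zero]
    have h2 : deltaIter F (fun m n => Tfirst F (compR F ΔV ΔM m n w)) (a + (b + d - N + 1))
        (d - (b + d - N + 1)) b = 0 :=
      finsum_eq_zero_of_forall_eq_zero fun i => by
        beta_reduce at hN ⊢
        rw [hN _ (by omega), map_zero, smul_zero]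
    simp only [X]
    rw [h1, h2, smul_zero, neg_zero, sub_zero]
  have h := congrArg (fun z => (-1 : F) ^ a • z) (sub_eq_zero.mp (hX.eq_zero h0 hline a d b))
  simp only [smul_smul, hsq, one_smul] at h
  rw [h, smul_neg, neg_smul]

/-- Transposing the first two factors exchanges the roles of `x₁` and `x₂` in the Jacobi defect. -/
lemma Tfirst_comoduleDefect (hVC : IsVertexCoalg F ΔV c) (hgr : IsGradedVC F ΔV gr)
    (hmod : IsComoduleSansJacobi F c ΔM gr grM)
    (hwassoc : ∀ (f : V ⊗[F] (V ⊗[F] M) →ₗ[F] F), GradedDualVVM F gr grM f →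
      ∃ k : ℕ, 0 < k ∧ WeakCoassoc F ΔV ΔM f k) (w : M) (a b d : ℤ) :
    Tfirst F (comoduleDefect ΔV ΔM w a b d) =
      -(-1 : F) ^ a • comoduleDefect ΔV ΔM w a d b := by
  rw [map_comoduleDefect _ _ (hmod.2.2.1 w), comoduleDefect, jacobiDefect, jacobiDefect,
    deltaIter_Tfirst_compR hVC hgr hmod hwassoc]
  simp only [Tfirst_Tfirst]
  have hsq : (-1 : F) ^ a * (-1 : F) ^ a = 1 := by
    rw [← mul_zpow]
    simp
  rw [smul_sub, smul_sub, smul_smul, neg_mul, hsq]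
  module

end WeakCoassociativity

/-- Let `(V, Y_V, c)` be a graded vertex coalgebra and `M` a
`ℚ`-graded vector space with `Y_M` satisfying all the axioms of a comodule over
`V` except possibly the Jacobi identity.  If `M` satisfies weak
coassociativity, then `Y_M` satisfies the comodule Jacobi identity, so `M` is a
comodule over the graded vertex coalgebra `V`. -/
theorem comodule_jacobi_from_weak_coassociativity
    (ΔV : ℤ → V →ₗ[F] V ⊗[F] V) (c : V →ₗ[F] F) (gr : ℤ → Submodule F V)
    (hVC : IsVertexCoalg F ΔV c) (hgr : IsGradedVC F ΔV gr)
    (ΔM : ℤ → M →ₗ[F] V ⊗[F] M) (grM : ℚ → Submodule F M)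
    (hmod : IsComoduleSansJacobi F c ΔM gr grM)
    (hwassoc : ∀ (f : V ⊗[F] (V ⊗[F] M) →ₗ[F] F), GradedDualVVM F gr grM f →
      ∃ k : ℕ, 0 < k ∧ WeakCoassoc F ΔV ΔM f k) :
    JacobiId F ΔV ΔM := by
  have hV := hgr.1
  obtain ⟨-, -, htrunc, hM, -, -⟩ := id hmod
  rw [jacobiId_iff htrunc]
  intro w a b d
  refine (resolves_gradedProj hV).tensor_tensor_eq_zero (resolves_gradedProj hV)
    (resolves_gradedProj hM) fun p q r => ?_
  rw [← Module.forall_dual_apply_eq_zero_iff F]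
  intro g
  obtain ⟨K, hK⟩ := exists_defect_plane_eq_zero hV hmod hM hwassoc p q r g w
  obtain ⟨K', hK'⟩ :=
    exists_defect_plane_eq_zero hV hmod hM hwassoc q p r (g ∘ₗ Tfirst F) w
  let X : ℤ → ℤ → ℤ → F := fun a b d => g (TensorProduct.map (gradedProj hV p)
    (TensorProduct.map (gradedProj hV q) (gradedProj hM r)) (comoduleDefect ΔV ΔM w a b d))
  have hX : DeltaRec X :=
    ((comoduleDefect_rec ΔV (htrunc w)).map (TensorProduct.map _ _)).map g
  refine hX.eq_zero hK (fun a b d => ⟨d - K', ?_⟩) a b d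
  simp only [X]
  rw [sub_sub_cancel, ← Tfirst_Tfirst (comoduleDefect ΔV ΔM w _ b K'),
    Tfirst_comoduleDefect hVC hgr hmod hwassoc, map_smul, map_smul, map_smul, map_map_Tfirst]
  exact smul_eq_zero_of_right _ (hK' _ _)
end
end
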